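/- A_n Watson transformation (Milne–Newcomb): Let n be a positive integer, N_1, …, N_n nonnegative integers with |N| = N_1 + ⋯ + N_n, q a nonzero complex number that is not a root of unity, and a, b, c, d, e, x_1, …, x_n nonzero complex numbers, generic so that no denominator below vanishes. Then ∑_{k_1=0}^{N_1} ⋯ ∑_{k_n=0}^{N_n} [ ∏_{1≤i<j≤n} (x_i·q^{k_i} − x_j·q^{k_j})/(x_i − x_j) · ∏_{i,j=1}^n (q^{−N_j}·x_i/x_j; q)_{k_i}/(q·x_i/x_j; q)_{k_i} · ∏_{i=1}^n (1 − a·x_i·q^{k_i+|k|})/(1 − a·x_i) · (a·x_i; q)_{|k|}/(a·x_i·q^{1+N_i}; q)_{|k|} · ∏_{i=1}^n (b·x_i; q)_{k_i}·(c·x_i; q)_{k_i} / [ (a·x_i·q/d; q)_{k_i}·(a·x_i·q/e; q)_{k_i} ] · (d; q)_{|k|}·(e; q)_{|k|} / [ (a·q/b; q)_{|k|}·(a·q/c; q)_{|k|} ] · (a²·q^{|N|+2}/(bcde))^{|k|} ] = (a·q/(ce); q)_{|N|}/(a·q/c; q)_{|N|} · ∏_{i=1}^n (a·x_i·q; q)_{N_i}/(a·x_i·q/e;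 q)_{N_i} · ∑_{k_1=0}^{N_1} ⋯ ∑_{k_n=0}^{N_n} [ ∏_{1≤i<j≤n} (x_i·q^{k_i} − x_j·q^{k_j})/(x_i − x_j) · ∏_{i,j=1}^n (q^{−N_j}·x_i/x_j; q)_{k_i}/(q·x_i/x_j; q)_{k_i} · ∏_{i=1}^n (c·x_i; q)_{k_i}/(a·x_i·q/d; q)_{k_i} · (a·q/(bd); q)_{|k|}·(e; q)_{|k|} / [ (a·q/b; q)_{|k|}·(c·e·q^{−|N|}/a; q)_{|k|} ] · q^{|k|} ], where |k| = k_1 + ⋯ + k_n. -/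

import Mathlib

open Finset

/-- The q-shifted factorial `(a;q)_k`. -/
noncomputable def qPoch (q a : ℂ) (k : ℕ) : ℂ := ∏ i ∈ Finset.range k, (1 - a * q ^ i)

namespace MilneWatson

section QShifted

variable (q a : ℂ)

lemma qPoch_zero : qPoch q a 0 = 1 := by simp [qPoch]

lemma qPoch_succ (k : ℕ) : qPoch q a (k + 1) = qPoch q a k * (1 - a * q ^ k) := by
  simp [qPoch, Finset.prod_range_succ]

lemma qPoch_add (k l : ℕ) : qPoch q a (k + l) = qPoch q a k * qPoch q (a * q ^ k) l := by
  simp only [qPoch, Finset.prod_range_add]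
  congr 1
  exact Finset.prod_congr rfl fun i _ => by ring

lemma qPoch_succ' (k : ℕ) : qPoch q a (k + 1) = (1 - a) * qPoch q (a * q) k := by
  rw [add_comm k 1, qPoch_add]
  simp [qPoch]

lemma qPoch_ne_zero_iff (k : ℕ) : qPoch q a k ≠ 0 ↔ ∀ s < k, 1 - a * q ^ s ≠ 0 := by
  simp [qPoch, Finset.prod_ne_zero_iff]

end QShifted

/-- The points `x i * q ^ k i`. -/
noncomputable def node (q : ℂ) {n : ℕ} (x : Fin n → ℂ) (k : Fin n → ℕ) : Fin n → ℂ :=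
  fun i => x i * q ^ k i

/-- The genericity of `q` and `x` under which the factors `(q x_i / x_j; q)_{k_i}` with `k ≤ N` and
the differences `x_i - x_j` do not vanish. -/
structure Separated (q : ℂ) {n : ℕ} (x : Fin n → ℂ) (N : Fin n → ℕ) : Prop where
  q_ne_zero : q ≠ 0
  q_pow_ne_one : ∀ m : ℕ, 0 < m → q ^ m ≠ 1
  ne_zero : ∀ i, x i ≠ 0
  mul_pow_ne : ∀ i j, i ≠ j → ∀ s ≤ N i, x i * q ^ s ≠ x j

/-- The common weight of the `A_n` basic hypergeometric sums. -/
noncomputable def weight (q : ℂ) {n : ℕ} (x : Fin n → ℂ) (N k : Fin n → ℕ) : ℂ :=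
  (∏ i, ∏ j, if i < j then (x i * q ^ k i - x j * q ^ k j) / (x i - x j) else 1) *
    ∏ i, ∏ j, qPoch q (q ^ (-(N j : ℤ)) * x i / x j) (k i) / qPoch q (q * x i / x j) (k i)

namespace Separated

variable {q : ℂ} {n : ℕ} {x : Fin n → ℂ} {N : Fin n → ℕ}

lemma mono (h : Separated q x N) {N' : Fin n → ℕ} (hN : N' ≤ N) : Separated q x N' :=
  ⟨h.1, h.2, h.3, fun i j hij s hs => h.4 i j hij s (hs.trans (hN i))⟩

lemma node_ne_zero (h : Separated q x N) (k : Fin n → ℕ) (i : Fin n) : node q x k i ≠ 0 :=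
  mul_ne_zero (h.ne_zero i) (pow_ne_zero _ h.q_ne_zero)

lemma mul_pow_ne_mul_pow (h : Separated q x N) {i j : Fin n} (hij : i ≠ j) {s t : ℕ}
    (hs : s ≤ N i) (ht : t ≤ N j) : x i * q ^ s ≠ x j * q ^ t := by
  intro he
  rcases le_total s t with hst | hst
  · obtain ⟨d, rfl⟩ := Nat.exists_eq_add_of_le hst
    refine h.mul_pow_ne j i hij.symm d (by omega) ?_
    have := pow_ne_zero s h.q_ne_zero
    apply mul_right_cancel₀ this
    rw [he]; ring
  · obtain ⟨d, rfl⟩ := Nat.exists_eq_add_of_le hst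
    refine h.mul_pow_ne i j hij d (by omega) ?_
    have := pow_ne_zero t h.q_ne_zero
    apply mul_right_cancel₀ this
    rw [← he]; ring

lemma node_sub_ne_zero (h : Separated q x N) {k : Fin n → ℕ} (hk : k ≤ N) {i j : Fin n}
    (hij : i ≠ j) : node q x k i - node q x k j ≠ 0 :=
  sub_ne_zero.2 (h.mul_pow_ne_mul_pow hij (hk i) (hk j))

lemma node_injective (h : Separated q x N) {k : Fin n → ℕ} (hk : k ≤ N) :
    Function.Injective (node q x k) := fun i j he => by
  by_contra hij
  exact h.node_sub_ne_zero hk hij (sub_eq_zero.2 he)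

lemma sub_ne_zero_of_lt (h : Separated q x N) {i j : Fin n} {s t : ℕ} (hs : s ≤ N i)
    (hts : t < s) (ht : t ≤ N j) : x i * q ^ s - x j * q ^ t ≠ 0 := by
  rw [sub_ne_zero]
  by_cases hij : i = j
  · subst hij
    obtain ⟨d, rfl⟩ := Nat.exists_eq_add_of_lt hts
    intro he
    apply h.q_pow_ne_one (d + 1) (by omega)
    apply mul_left_cancel₀ (mul_ne_zero (h.ne_zero i) (pow_ne_zero t h.q_ne_zero))
    linear_combination he
  · exact h.mul_pow_ne_mul_pow hij hs ht

lemma shift (h : Separated q x N) {j : Fin n → ℕ} (hj : j ≤ N) :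
    Separated q (node q x j) (N - j) := by
  refine ⟨h.1, h.2, h.node_ne_zero j, fun a b hab s hs => ?_⟩
  simp only [Pi.sub_apply] at hs
  simp only [node, mul_assoc, ← pow_add]
  exact h.mul_pow_ne_mul_pow hab (by have : j a ≤ N a := hj a; omega) (hj b)

end Separated

section Weight

lemma prod_prod_split {n : ℕ} (f : Fin n → Fin n → ℂ) (m : Fin n) :
    ∏ i, ∏ j, f i j = f m m * (∏ j ∈ univ.erase m, f m j * f j m) *
      ∏ i ∈ univ.erase m, ∏ j ∈ univ.erase m, f i j := by
  rw [← Finset.mul_prod_erase univ _ (mem_univ m), ← Finset.mul_prod_erase univ _ (mem_univ m),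
    Finset.prod_congr rfl fun i _ => (Finset.mul_prod_erase univ (f i) (mem_univ m)).symm,
    Finset.prod_mul_distrib, Finset.prod_mul_distrib]
  ring

lemma vandermonde_update {n : ℕ} (x z z' : Fin n → ℂ) (m : Fin n) (h : ∀ j ≠ m, z' j = z j) :
    (∏ i, ∏ j, if i < j then (z' i - z' j) / (x i - x j) else 1) *
        ∏ j ∈ univ.erase m, (z m - z j) =
      (∏ i, ∏ j, if i < j then (z i - z j) / (x i - x j) else 1) *
        ∏ j ∈ univ.erase m, (z' m - z j) := by
  rw [prod_prod_split _ m, prod_prod_split (fun i j => if i < j then (z i - z j) / _ else 1) m]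
  have h1 : (∏ i ∈ univ.erase m, ∏ j ∈ univ.erase m,
      if i < j then (z' i - z' j) / (x i - x j) else 1) =
      ∏ i ∈ univ.erase m, ∏ j ∈ univ.erase m,
        if i < j then (z i - z j) / (x i - x j) else 1 :=
    Finset.prod_congr rfl fun i hi => Finset.prod_congr rfl fun j hj => by
      rw [h i (ne_of_mem_erase hi), h j (ne_of_mem_erase hj)]
  have h2 : (∏ j ∈ univ.erase m, ((if m < j then (z' m - z' j) / (x m - x j) else 1) *
        (if j < m then (z' j - z' m) / (x j - x m) else 1))) * ∏ j ∈ univ.erase m, (z m - z j) =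
      (∏ j ∈ univ.erase m, ((if m < j then (z m - z j) / (x m - x j) else 1) *
        (if j < m then (z j - z m) / (x j - x m) else 1))) *
          ∏ j ∈ univ.erase m, (z' m - z j) := by
    rw [← Finset.prod_mul_distrib, ← Finset.prod_mul_distrib]
    refine Finset.prod_congr rfl fun j hj => ?_
    rw [h j (ne_of_mem_erase hj)]
    rcases lt_trichotomy m j with hmj | hmj | hmj
    · simp only [hmj, hmj.not_gt, if_true, if_false]; ring
    · exact absurd hmj.symm (ne_of_mem_erase hj)
    · simp only [hmj, hmj.not_gt, if_true, if_false]; ring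
  rw [h1]
  simp only [lt_self_iff_false, if_false, one_mul]
  linear_combination (∏ i ∈ univ.erase m, ∏ j ∈ univ.erase m,
        if i < j then (z i - z j) / (x i - x j) else 1) * h2

variable {q : ℂ} {n : ℕ} {x : Fin n → ℂ} {N : Fin n → ℕ}

/-- Adding one to the entry of index `m`. -/
def raise {n : ℕ} (k : Fin n → ℕ) (m : Fin n) : Fin n → ℕ := k + Pi.single m 1

@[simp] lemma raise_self (k : Fin n → ℕ) (m : Fin n) : raise k m m = k m + 1 := by
  simp [raise]

lemma raise_of_ne (k : Fin n → ℕ) {m j : Fin n} (h : j ≠ m) : raise k m j = k j := by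
  simp [raise, h]

lemma le_raise (k : Fin n → ℕ) (m : Fin n) : k ≤ raise k m := by
  simp [raise]

lemma sum_raise (k : Fin n → ℕ) (m : Fin n) :
    ∑ i, raise k m i = ∑ i, k i + 1 := by
  simp [raise, Finset.sum_add_distrib]

lemma node_raise_of_ne (k : Fin n → ℕ) {m j : Fin n} (h : j ≠ m) :
    node q x (raise k m) j = node q x k j := by
  simp [node, raise_of_ne k h]

lemma node_raise_self (k : Fin n → ℕ) (m : Fin n) :
    node q x (raise k m) m = q * node q x k m := by
  simp [node, pow_succ]; ring

lemma node_node (j m : Fin n → ℕ) : node q (node q x j) m = node q x (j + m) := by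
  ext i; simp [node, pow_add, mul_assoc]

lemma prod_raise (g : Fin n → ℕ → ℂ) (k : Fin n → ℕ) (m : Fin n) {r : ℂ}
    (hr : g m (k m + 1) = g m (k m) * r) :
    ∏ i, g i (raise k m i) = (∏ i, g i (k i)) * r := by
  rw [← Finset.mul_prod_erase univ _ (mem_univ m),
    ← Finset.mul_prod_erase univ (fun i => g i (k i)) (mem_univ m)]
  have : ∏ i ∈ univ.erase m, g i (raise k m i) = ∏ i ∈ univ.erase m, g i (k i) :=
    Finset.prod_congr rfl fun i hi => by rw [raise_of_ne k (ne_of_mem_erase hi)]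
  rw [this]
  rw [raise_self, hr]
  ring

lemma prod_pow_sum (k : Fin n → ℕ) : ∏ i, q ^ k i = q ^ ∑ i, k i :=
  Finset.prod_pow_eq_pow_sum _ _ _

lemma weight_eq_zero (hx : ∀ i, x i ≠ 0) (hq : q ≠ 0) {k : Fin n → ℕ} (hk : ¬ k ≤ N) :
    weight q x N k = 0 := by
  obtain ⟨i, hi⟩ : ∃ i, N i < k i := by simpa [Pi.le_def] using hk
  unfold weight
  refine mul_eq_zero_of_right _ (Finset.prod_eq_zero (mem_univ i)
    (Finset.prod_eq_zero (mem_univ i) ?_))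
  rw [div_eq_zero_iff]
  left
  refine Finset.prod_eq_zero (Finset.mem_range.2 hi) ?_
  have := hx i
  rw [mul_div_assoc, div_self this, mul_one, zpow_neg, zpow_natCast, inv_mul_cancel₀, sub_self]
  exact pow_ne_zero _ hq

lemma weight_zero (h : Separated q x N) : weight q x N 0 = 1 := by
  unfold weight
  simp only [Pi.zero_apply, pow_zero, mul_one, qPoch_zero, div_one, Finset.prod_const_one]
  refine Finset.prod_eq_one fun i _ => Finset.prod_eq_one fun j _ => ?_
  split_ifs with hij
  · have := h.node_sub_ne_zero (k := 0) (by intro i; simp) hij.ne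
    simp only [node, Pi.zero_apply, pow_zero, mul_one] at this
    exact div_self this
  · rfl

/-- The effect on the weight of raising a summation index. -/
lemma weight_raise (h : Separated q x N) {k : Fin n → ℕ} {m : Fin n}
    (hk : raise k m ≤ N) :
    weight q x N (raise k m) * (∏ j ∈ univ.erase m, (node q x k m - node q x k j)) *
        (∏ j, (q * node q x k m - x j)) * q ^ ∑ i, N i =
      weight q x N k * (∏ j ∈ univ.erase m, (q * node q x k m - node q x k j)) *
        ∏ j, (node q x k m - node q x N j) := by
  have hkm : k m + 1 ≤ N m := by simpa using hk m
  have hV := vandermonde_update x (node q x k) (node q x (raise k m)) m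
    fun j hj => node_raise_of_ne k hj
  rw [node_raise_self] at hV
  have hP := prod_raise (fun i t => ∏ j, qPoch q (q ^ (-(N j : ℤ)) * x i / x j) t /
    qPoch q (q * x i / x j) t) k m (r := ∏ j, (1 - q ^ (-(N j : ℤ)) * x m / x j * q ^ k m) /
      (1 - q * x m / x j * q ^ k m)) (by
    simp only [qPoch_succ, ← Finset.prod_mul_distrib]
    exact Finset.prod_congr rfl fun j _ => mul_div_mul_comm _ _ _ _)
  have hr : (∏ j, (1 - q ^ (-(N j : ℤ)) * x m / x j * q ^ k m) /
      (1 - q * x m / x j * q ^ k m)) * (∏ j, (q * node q x k m - x j)) * q ^ ∑ i, N i =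
      ∏ j, (node q x k m - node q x N j) := by
    rw [← prod_pow_sum, ← Finset.prod_mul_distrib, ← Finset.prod_mul_distrib]
    refine Finset.prod_congr rfl fun j _ => ?_
    have h1 := h.sub_ne_zero_of_lt (i := m) (j := j) (s := k m + 1) (t := 0) hkm (by omega)
      (by omega)
    have h2 := h.ne_zero j
    have h3 := pow_ne_zero (N j) h.q_ne_zero
    have h4 : x j - q * x m * q ^ k m ≠ 0 := by
      intro h0; apply h1; rw [pow_zero, pow_succ]; linear_combination -h0
    have h5 : 1 - q * x m / x j * q ^ k m ≠ 0 := by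
      intro h0; apply h4; field_simp at h0; linear_combination h0
    rw [zpow_neg, zpow_natCast, div_mul_eq_mul_div, div_mul_eq_mul_div, div_eq_iff h5]
    unfold node
    field_simp
    ring
  rw [← hr]
  simp only [node] at hV
  simp only [node, weight]
  rw [hP]
  linear_combination (∏ i, ∏ j, qPoch q (q ^ (-(N j : ℤ)) * x i / x j) (k i) /
    qPoch q (q * x i / x j) (k i)) * (∏ j, (1 - q ^ (-(N j : ℤ)) * x m / x j * q ^ k m) /
      (1 - q * x m / x j * q ^ k m)) * (∏ j, (q * (x m * q ^ k m) - x j)) * q ^ (∑ i, N i) * hV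

/-- The effect on the weight of raising an upper limit. -/
lemma weight_raise_left (hx : ∀ i, x i ≠ 0) (hq : q ≠ 0) (k : Fin n → ℕ) (m : Fin n) :
    weight q x (raise N m) k * ∏ i, (q * node q x N m - node q x k i) =
      weight q x N k * ∏ i, (q * node q x N m - x i) := by
  have hj : ∀ i, (∏ j, qPoch q (q ^ (-(raise N m j : ℤ)) * x i / x j) (k i)) *
      (q * node q x N m - node q x k i) =
      (∏ j, qPoch q (q ^ (-(N j : ℤ)) * x i / x j) (k i)) * (q * node q x N m - x i) := by
    intro i
    rw [← Finset.mul_prod_erase univ _ (mem_univ m), ← Finset.mul_prod_erase univ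
      (fun j => qPoch q (q ^ (-(N j : ℤ)) * x i / x j) (k i)) (mem_univ m)]
    have h1 : ∏ j ∈ univ.erase m,
        qPoch q (q ^ (-(raise N m j : ℤ)) * x i / x j) (k i) =
        ∏ j ∈ univ.erase m, qPoch q (q ^ (-(N j : ℤ)) * x i / x j) (k i) :=
      Finset.prod_congr rfl fun j hj => by rw [raise_of_ne N (ne_of_mem_erase hj)]
    have h2 := qPoch_succ q (q ^ (-((N m : ℤ) + 1)) * x i / x m) (k i)
    rw [qPoch_succ'] at h2
    have h3 : q ^ (-((N m : ℤ) + 1)) * x i / x m * q = q ^ (-(N m : ℤ)) * x i / x m := by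
      rw [neg_add, zpow_add₀ hq, zpow_neg_one]
      field_simp
    rw [h3] at h2
    have h4 : ∀ y, x m * q ^ (N m + 1) * (1 - q ^ (-((N m : ℤ) + 1)) * x i / x m * y) =
        q * node q x N m - x i * y := by
      intro y
      have := hx m
      unfold node
      rw [zpow_neg, ← Nat.cast_succ, zpow_natCast]
      field_simp
      ring
    have h5 := h4 (q ^ k i)
    have h6 := h4 1
    rw [mul_one, mul_one] at h6
    rw [raise_self, Nat.cast_add, Nat.cast_one]
    rw [h1, ← h6]
    change _ * (q * node q x N m - x i * q ^ k i) = _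
    rw [← h5]
    linear_combination (-(x m * q ^ (N m + 1)) * ∏ j ∈ univ.erase m,
      qPoch q (q ^ (-(N j : ℤ)) * x i / x j) (k i)) * h2
  unfold weight
  have hprod := Finset.prod_congr (s₁ := univ) rfl fun i _ => hj i
  rw [Finset.prod_mul_distrib, Finset.prod_mul_distrib] at hprod
  simp only [Finset.prod_div_distrib]
  rw [mul_div_assoc', div_mul_eq_mul_div, mul_assoc, hprod]
  ring

lemma raise_sub_single {k : Fin n → ℕ} {m : Fin n} (h : k m ≠ 0) :
    raise (k - Pi.single m 1) m = k := by
  funext j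
  by_cases hj : j = m
  · subst hj; simp; omega
  · rw [raise_of_ne _ hj]; simp [hj]

lemma sub_single_raise (k : Fin n → ℕ) (m : Fin n) : raise k m - Pi.single m 1 = k := by
  simp [raise]

lemma raise_induction {P : (Fin n → ℕ) → Prop} (zero : P 0)
    (raise : ∀ k m, P k → P (raise k m)) (k : Fin n → ℕ) : P k := by
  induction hK : ∑ i, k i generalizing k with
  | zero =>
    have : k = 0 := by
      funext i
      simpa using Finset.sum_eq_zero_iff.1 hK i (mem_univ i)
    exact this ▸ zero
  | succ K ih =>
    obtain ⟨m, -, hm⟩ := Finset.exists_ne_zero_of_sum_ne_zero (hK.trans_ne K.succ_ne_zero)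
    rw [← raise_sub_single hm] at hK ⊢
    rw [sum_raise] at hK
    exact raise _ _ (ih _ (by omega))

lemma prod_erase_ne_zero (h : Separated q x N) {k : Fin n → ℕ} (hk : k ≤ N) (m : Fin n) :
    ∏ j ∈ univ.erase m, (node q x k m - node q x k j) ≠ 0 :=
  Finset.prod_ne_zero_iff.2 fun _ hj => h.node_sub_ne_zero hk (ne_of_mem_erase hj).symm

lemma prod_mul_node_sub_ne_zero (h : Separated q x N) {k l : Fin n → ℕ} {m : Fin n}
    (hk : raise k m ≤ N) (hl : l ≤ k) : ∏ j, (q * node q x k m - node q x l j) ≠ 0 := by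
  refine Finset.prod_ne_zero_iff.2 fun j _ => ?_
  have hkm : k m + 1 ≤ N m := by simpa using hk m
  have hlj : l j ≤ N j := (hl j).trans ((le_raise k m j).trans (hk j))
  by_cases hlt : l j ≤ k m
  · have := h.sub_ne_zero_of_lt (i := m) (j := j) hkm (t := l j) (by omega) hlj
    unfold node
    intro h0
    apply this
    rw [pow_succ]
    linear_combination h0
  · have hjm : m ≠ j := by
      rintro rfl
      exact hlt (hl m)
    have := h.mul_pow_ne_mul_pow hjm hkm hlj
    unfold node
    intro h0
    apply this
    rw [pow_succ]
    linear_combination h0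

lemma node_zero : node q x 0 = x := by
  funext i; simp [node]

lemma weight_self {k : Fin n → ℕ} (h : Separated q x k) :
    weight q x k k * q ^ (∑ i, k i + 1).choose 2 = (-1) ^ ∑ i, k i := by
  induction k using raise_induction with
  | zero => simp [weight_zero h]
  | raise k m ih =>
    have hk := h.mono (le_raise k m)
    have h1 := weight_raise h le_rfl
    have h2 := weight_raise_left (N := k) h.ne_zero h.q_ne_zero k m
    have hA := prod_erase_ne_zero h (le_raise k m) m
    have hB := prod_mul_node_sub_ne_zero h le_rfl (l := 0) (fun i => (k i).zero_le)
    rw [node_zero] at hB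
    have hD : ∏ j, (node q x k m - node q x (raise k m) j) =
        (node q x k m - q * node q x k m) * ∏ j ∈ univ.erase m, (node q x k m - node q x k j) := by
      rw [← Finset.mul_prod_erase univ _ (mem_univ m), node_raise_self]
      congr 1
      exact Finset.prod_congr rfl fun j hj => by rw [node_raise_of_ne k (ne_of_mem_erase hj)]
    rw [← Finset.mul_prod_erase univ (fun i => q * node q x k m - node q x k i) (mem_univ m)] at h2
    rw [hD] at h1
    rw [sum_raise] at h1 ⊢
    rw [Nat.choose_succ_succ' _ 1, Nat.choose_one_right, pow_add, pow_succ (-1 : ℂ), ← ih hk]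
    apply mul_right_cancel₀ hA
    apply mul_right_cancel₀ hB
    linear_combination q ^ (∑ i, k i + 1).choose 2 * h1 - q ^ (∑ i, k i + 1).choose 2 *
      (∏ j ∈ univ.erase m, (node q x k m - node q x k j)) * h2

lemma add_raise (j m : Fin n → ℕ) (i : Fin n) : j + raise m i = raise (j + m) i :=
  (add_assoc _ _ _).symm

lemma sum_sub_add (h : Fin n → ℕ) {j : Fin n → ℕ} (hj : j ≤ h) :
    ∑ i, (h - j) i + ∑ i, j i = ∑ i, h i := by
  rw [← Finset.sum_add_distrib]
  exact Finset.sum_congr rfl fun i _ => Nat.sub_add_cancel (hj i)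

/-- The factorization of a product of two weights that share an index. -/
lemma weight_mul_weight (h : Separated q x N) {j m : Fin n → ℕ} (hjm : j + m ≤ N) :
    weight q x N (j + m) * weight q x (j + m) j * q ^ ((∑ i, j i) * ∑ i, m i) =
      weight q x j j * weight q x N j * weight q (node q x j) (N - j) m := by
  have hj : j ≤ N := le_self_add.trans hjm
  induction m using raise_induction with
  | zero => simp [weight_zero (h.shift hj)]; ring
  | raise m i ih =>
    rw [add_raise] at hjm ⊢
    have hm : raise m i ≤ N - j := by
      intro b
      have : j b + raise m i b ≤ N b := by
        rw [← Pi.add_apply, add_raise]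
        exact hjm b
      exact Nat.le_sub_of_add_le' this
    have h1 := weight_raise h hjm
    have h2 := weight_raise_left (N := j + m) h.ne_zero h.q_ne_zero j i
    have h3 := weight_raise (h.shift hj) hm
    simp only [node_node, add_tsub_cancel_of_le hj] at h3
    have hA := prod_erase_ne_zero h ((le_raise _ _).trans hjm) i
    have hB := prod_mul_node_sub_ne_zero h hjm (l := 0) (fun i => Nat.zero_le _)
    have hE := prod_mul_node_sub_ne_zero h hjm (l := j) le_self_add
    rw [node_zero] at hB
    have hih := ih ((le_raise _ _).trans hjm)
    have hN := sum_sub_add N hj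
    rw [← hN, pow_add] at h1
    have hq := pow_ne_zero (∑ i, (N - j) i) h.q_ne_zero
    rw [sum_raise, mul_add, mul_one, pow_add]
    apply mul_right_cancel₀ hA
    apply mul_right_cancel₀ hB
    apply mul_right_cancel₀ hE
    apply mul_right_cancel₀ hq
    linear_combination q ^ ((∑ i, j i) * ∑ i, m i) * weight q x (raise (j + m) i) j *
        (∏ l, (q * node q x (j + m) i - node q x j l)) * h1 +
      q ^ ((∑ i, j i) * ∑ i, m i) * weight q x N (j + m) *
        (∏ l ∈ univ.erase i, (q * node q x (j + m) i - node q x (j + m) l)) *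
        (∏ l, (node q x (j + m) i - node q x N l)) * h2 +
      (∏ l, (q * node q x (j + m) i - x l)) *
        (∏ l ∈ univ.erase i, (q * node q x (j + m) i - node q x (j + m) l)) *
        (∏ l, (node q x (j + m) i - node q x N l)) * hih -
      weight q x j j * weight q x N j * (∏ l, (q * node q x (j + m) i - x l)) * h3

end Weight

lemma sum_Iic_raise {n : ℕ} {N : Fin n → ℕ} (i : Fin n) (G H : (Fin n → ℕ) → ℂ)
    (hH : ∀ k ≤ N, k i < N i → H k = G (raise k i)) (hH0 : ∀ k ≤ N, k i = N i → H k = 0)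
    (hG0 : ∀ k ≤ N, k i = 0 → G k = 0) :
    ∑ k ∈ Iic N, H k = ∑ k ∈ Iic N, G k := by
  rw [← Finset.sum_filter_of_ne (s := Iic N) (f := H) (p := fun k => k i < N i),
    ← Finset.sum_filter_of_ne (s := Iic N) (f := G) (p := fun k => k i ≠ 0)]
  · refine Finset.sum_nbij' (fun k => raise k i) (fun k => k - Pi.single i 1) ?_ ?_ ?_ ?_ ?_
    · intro k hk
      simp only [mem_filter, mem_Iic, raise_self] at hk ⊢
      refine ⟨fun j => ?_, by omega⟩
      by_cases hj : j = i
      · subst hj; rw [raise_self]; exact hk.2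
      · rw [raise_of_ne k hj]; exact hk.1 j
    · intro k hk
      simp only [mem_filter, mem_Iic] at hk ⊢
      refine ⟨tsub_le_self.trans hk.1, ?_⟩
      have : k i ≤ N i := hk.1 i
      have h1 : (k - (Pi.single i 1 : Fin n → ℕ)) i = k i - 1 := by simp
      omega
    · intro k _
      exact sub_single_raise k i
    · intro k hk
      exact raise_sub_single (mem_filter.1 hk).2
    · intro k hk
      simp only [mem_filter, mem_Iic] at hk
      exact hH k hk.1 hk.2
  · intro k hk h0 h1
    exact h0 (hG0 k (mem_Iic.1 hk) h1)
  · intro k hk h0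
    exact lt_of_le_of_ne (mem_Iic.1 hk i) fun h1 => h0 (hH0 k (mem_Iic.1 hk) h1)

section Interpolation

open Polynomial

variable {n : ℕ} {z : Fin n → ℂ}

lemma exists_X_mul_eq (hz0 : ∀ i, z i ≠ 0) {p : ℂ[X]} (hp : p.natDegree ≤ n + 1) :
    ∃ r : ℂ[X], r.degree < n ∧ X * r = p - Lagrange.nodal univ z *
      (C (p.coeff (n + 1)) * X + C (p.eval 0 / ∏ j, (-z j))) := by
  set P := p - Lagrange.nodal univ z * (C (p.coeff (n + 1)) * X + C (p.eval 0 / ∏ j, (-z j)))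
    with hP
  have hprod : ∏ j, (-z j) ≠ 0 := Finset.prod_ne_zero_iff.2 fun j _ => neg_ne_zero.2 (hz0 j)
  have h0 : P.coeff 0 = 0 := by
    rw [coeff_zero_eq_eval_zero, hP]
    simp only [eval_sub, eval_mul, Lagrange.eval_nodal, eval_add, eval_C, eval_X, zero_sub]
    field_simp
    ring
  refine ⟨P.divX, ?_, ?_⟩
  · rw [degree_lt_iff_coeff_zero]
    intro m hm
    have hdeg : (Lagrange.nodal univ z).natDegree = n := by simp [Lagrange.natDegree_nodal]
    have h1 : (Lagrange.nodal univ z).coeff (m + 1) = 0 :=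
      coeff_eq_zero_of_natDegree_lt (by omega)
    rw [coeff_divX, hP, mul_add, ← mul_assoc, coeff_sub, coeff_add, coeff_mul_X, coeff_mul_C,
      coeff_mul_C, h1]
    rcases hm.eq_or_lt with rfl | hlt
    · have h2 : (Lagrange.nodal univ z).coeff n = 1 := by
        have := (Lagrange.nodal_monic (s := univ) (v := z)).coeff_natDegree
        rwa [hdeg] at this
      rw [h2]; ring
    · rw [coeff_eq_zero_of_natDegree_lt (p := p) (by omega),
        coeff_eq_zero_of_natDegree_lt (p := Lagrange.nodal univ z) (by omega)]
      ring
  · have := P.X_mul_divX_add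
    rw [h0] at this
    simpa using this

lemma sum_eval_div_node (hn : 0 < n) (hz : Function.Injective z) (hz0 : ∀ i, z i ≠ 0) {p : ℂ[X]}
    (hp : p.natDegree ≤ n) :
    ∑ i, p.eval (z i) / (z i * ∏ j ∈ univ.erase i, (z i - z j)) =
      p.coeff n - p.eval 0 / ∏ j, (-z j) := by
  obtain ⟨r, hr, hX⟩ := exists_X_mul_eq hz0 (hp.trans n.le_succ)
  rw [coeff_eq_zero_of_natDegree_lt (by omega : p.natDegree < n + 1)] at hX
  have h1 := Lagrange.coeff_eq_sum (s := univ) hz.injOn (P := r) (by simpa using hr)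
  have h2 := congrArg (fun P => coeff P (n - 1 + 1)) hX
  have h3 : (Lagrange.nodal univ z).coeff n = 1 := by
    have := (Lagrange.nodal_monic (s := univ) (v := z)).coeff_natDegree
    simpa [Lagrange.natDegree_nodal] using this
  simp only [coeff_X_mul] at h2
  simp only [Nat.sub_add_cancel hn, coeff_sub, map_zero, zero_mul, zero_add, coeff_mul_C, h3,
    one_mul] at h2
  simp only [card_univ, Fintype.card_fin] at h1
  rw [← h2, h1]
  refine Finset.sum_congr rfl fun i _ => ?_
  have h4 := congrArg (eval (z i)) hX
  simp only [eval_mul, eval_X, eval_sub, Lagrange.eval_nodal_at_node (mem_univ i), zero_mul,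
    sub_zero] at h4
  rw [← h4, mul_div_mul_left _ _ (hz0 i)]

lemma sum_eval_mul_prod_div_node (hz : Function.Injective z) (hz0 : ∀ i, z i ≠ 0)
    {p : ℂ[X]} (hp : p.natDegree ≤ n + 1) {w : ℂ} (hw : w ≠ 0) :
    ∑ i, p.eval (z i) * (∏ j ∈ univ.erase i, (w - z j)) /
        (z i * ∏ j ∈ univ.erase i, (z i - z j)) =
      (p.eval w - (∏ j, (w - z j)) * (p.coeff (n + 1) * w + p.eval 0 / ∏ j, (-z j))) / w := by
  obtain ⟨r, hr, hX⟩ := exists_X_mul_eq hz0 hp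
  have h1 := Lagrange.eq_interpolate (s := univ) hz.injOn (f := r) (by simpa using hr)
  have h2 := congrArg (eval w) hX
  simp only [eval_mul, eval_X, eval_sub, Lagrange.eval_nodal, eval_add, eval_C] at h2
  rw [← h2, mul_div_cancel_left₀ _ hw, h1, Lagrange.interpolate_apply, eval_finsetSum]
  refine Finset.sum_congr rfl fun i _ => ?_
  have h4 := congrArg (eval (z i)) hX
  simp only [eval_mul, eval_X, eval_sub, Lagrange.eval_nodal_at_node (mem_univ i), zero_mul,
    sub_zero] at h4
  simp only [eval_mul, eval_C, Lagrange.basis, eval_prod, Lagrange.basisDivisor, eval_sub, eval_X,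
    Finset.prod_mul_distrib, Finset.prod_inv_distrib]
  rw [← h4, mul_assoc, mul_div_mul_left _ _ (hz0 i)]
  ring

lemma natDegree_nodal_mul_one_sub_le (s : Finset (Fin n)) (y : Fin n → ℂ) (a : ℂ) :
    (Lagrange.nodal s y * (1 - C a * X)).natDegree ≤ #s + 1 := by
  refine natDegree_mul_le.trans (add_le_add (Lagrange.natDegree_nodal).le ?_)
  refine (natDegree_sub_le _ _).trans (max_le (by simp) ?_)
  exact (natDegree_C_mul_le _ _).trans natDegree_X_le

lemma coeff_nodal_mul_one_sub (s : Finset (Fin n)) (y : Fin n → ℂ) (a : ℂ) :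
    (Lagrange.nodal s y * (1 - C a * X)).coeff (#s + 1) = -a := by
  have hdeg : (Lagrange.nodal s y).natDegree = #s := Lagrange.natDegree_nodal
  have h1 : (Lagrange.nodal s y).coeff #s = 1 := by
    have := (Lagrange.nodal_monic (s := s) (v := y)).coeff_natDegree
    rwa [hdeg] at this
  have h2 : (Lagrange.nodal s y).coeff (#s + 1) = 0 := coeff_eq_zero_of_natDegree_lt (by omega)
  rw [mul_sub, mul_one, coeff_sub, h2, mul_left_comm, coeff_C_mul, coeff_mul_X, h1]
  ring

lemma sum_prod_erase_div_node (hz : Function.Injective z) (hz0 : ∀ i, z i ≠ 0) (y : Fin n → ℂ)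
    (m : Fin n) (a : ℂ) :
    ∑ i, (∏ j ∈ univ.erase m, (z i - y j)) * (1 - a * z i) /
        (z i * ∏ j ∈ univ.erase i, (z i - z j)) =
      -a - (∏ j ∈ univ.erase m, (-y j)) / ∏ j, (-z j) := by
  have hn : 0 < n := Fin.pos m
  have hs : #(univ.erase m) + 1 = n := by
    rw [card_erase_of_mem (mem_univ m), card_univ, Fintype.card_fin]; omega
  have h1 := natDegree_nodal_mul_one_sub_le (univ.erase m) y a
  have h2 := coeff_nodal_mul_one_sub (univ.erase m) y a
  rw [hs] at h1 h2
  have h3 := sum_eval_div_node hn hz hz0 h1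
  simpa [h2, Lagrange.eval_nodal] using h3

lemma sum_prod_mul_prod_div_node (hz : Function.Injective z) (hz0 : ∀ i, z i ≠ 0)
    (x : Fin n → ℂ) (c : ℂ) {w : ℂ} (hw : w ≠ 0) :
    ∑ i, (∏ j, (z i - x j)) * (1 - c * z i) * (∏ j ∈ univ.erase i, (w - z j)) /
        (z i * ∏ j ∈ univ.erase i, (z i - z j)) =
      ((∏ j, (w - x j)) * (1 - c * w) -
        (∏ j, (w - z j)) * (-c * w + (∏ j, (-x j)) / ∏ j, (-z j))) / w := by
  have h1 := natDegree_nodal_mul_one_sub_le univ x c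
  have h2 := coeff_nodal_mul_one_sub univ x c
  rw [card_univ, Fintype.card_fin] at h1 h2
  have h3 := sum_eval_mul_prod_div_node hz hz0 h1 hw
  rw [h2] at h3
  simpa [Lagrange.eval_nodal] using h3

end Interpolation

section Saalschutz

variable {q : ℂ} {n : ℕ} {x : Fin n → ℂ} {N : Fin n → ℕ} {a b c D : ℂ}

/-- The summand of the `A_n` Pfaff–Saalschütz sum, with an arbitrary lower parameter `D`. -/
noncomputable def saalTerm (q : ℂ) {n : ℕ} (x : Fin n → ℂ) (N : Fin n → ℕ) (a b c D : ℂ)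
    (k : Fin n → ℕ) : ℂ :=
  weight q x N k * (∏ i, qPoch q (a * x i) (k i) / qPoch q (c * x i) (k i)) *
    (qPoch q b (∑ i, k i) / qPoch q D (∑ i, k i)) * q ^ ∑ i, k i

lemma saalTerm_raise (h : Separated q x N) {k : Fin n → ℕ} {m : Fin n} (hk : raise k m ≤ N)
    (hc : 1 - c * node q x k m ≠ 0) (hD : 1 - D * q ^ ∑ i, k i ≠ 0) :
    saalTerm q x N a b c D (raise k m) * (∏ j ∈ univ.erase m, (node q x k m - node q x k j)) *
        (∏ j, (q * node q x k m - x j)) * q ^ (∑ i, N i) * (1 - c * node q x k m) *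
        (1 - D * q ^ ∑ i, k i) =
      saalTerm q x N a b c D k * (∏ j ∈ univ.erase m, (q * node q x k m - node q x k j)) *
        (∏ j, (node q x k m - node q x N j)) * (1 - a * node q x k m) *
        (1 - b * q ^ ∑ i, k i) * q := by
  have h1 := weight_raise h hk
  have h2 := prod_raise (fun i s => qPoch q (a * x i) s / qPoch q (c * x i) s) k m
    (r := (1 - a * node q x k m) / (1 - c * node q x k m)) (by
      simp only [qPoch_succ, node]
      rw [mul_div_mul_comm]
      ring_nf)
  unfold saalTerm
  rw [h2, sum_raise, qPoch_succ, qPoch_succ, mul_div_mul_comm, pow_succ q (∑ i, k i)]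
  generalize ∏ i, qPoch q (a * x i) (k i) / qPoch q (c * x i) (k i) = P
  generalize qPoch q b (∑ i, k i) / qPoch q D (∑ i, k i) = R
  have e1 : (1 - a * node q x k m) / (1 - c * node q x k m) * (1 - c * node q x k m) =
    1 - a * node q x k m := div_mul_cancel₀ _ hc
  have e2 : (1 - b * q ^ ∑ i, k i) / (1 - D * q ^ ∑ i, k i) * (1 - D * q ^ ∑ i, k i) =
    1 - b * q ^ ∑ i, k i := div_mul_cancel₀ _ hD
  generalize (1 - a * node q x k m) / (1 - c * node q x k m) = r at e1 ⊢
  generalize (1 - b * q ^ ∑ i, k i) / (1 - D * q ^ ∑ i, k i) = s at e2 ⊢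
  linear_combination P * r * R * s * q ^ (∑ i, k i) * q * (1 - c * node q x k m) *
    (1 - D * q ^ ∑ i, k i) * h1 + weight q x N k *
    (∏ j ∈ univ.erase m, (q * node q x k m - node q x k j)) *
    (∏ j, (node q x k m - node q x N j)) * P * R * q ^ (∑ i, k i) * q *
    (s * (1 - D * q ^ ∑ i, k i) * e1 + (1 - a * node q x k m) * e2)

lemma saalTerm_raise_left (hx : ∀ i, x i ≠ 0) (hq : q ≠ 0) (k : Fin n → ℕ) (m : Fin n)
    (h1 : k ≤ N → qPoch q (D * q) (∑ i, k i) ≠ 0) (h2 : k ≤ N → qPoch q D (∑ i, k i) ≠ 0) :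
    saalTerm q x N a b c (D * q) k * (1 - D * q ^ ∑ i, k i) *
        ∏ i, (q * node q x N m - x i) =
      saalTerm q x (raise N m) a b c D k * (1 - D) * ∏ i, (q * node q x N m - node q x k i) := by
  have hw := weight_raise_left (N := N) hx hq k m
  unfold saalTerm
  by_cases hk : k ≤ N
  · have e := qPoch_succ (q := q) (a := D) (∑ i, k i)
    rw [qPoch_succ'] at e
    have h1 := h1 hk
    have h2 := h2 hk
    have e' : (1 - D * q ^ ∑ i, k i) / qPoch q (D * q) (∑ i, k i) =
        (1 - D) / qPoch q D (∑ i, k i) := by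
      rw [div_eq_div_iff h1 h2]; linear_combination -e
    calc _ = (weight q x N k * ∏ i, (q * node q x N m - x i)) *
          (∏ i, qPoch q (a * x i) (k i) / qPoch q (c * x i) (k i)) * qPoch q b (∑ i, k i) *
          ((1 - D * q ^ ∑ i, k i) / qPoch q (D * q) (∑ i, k i)) * q ^ ∑ i, k i := by ring
      _ = _ := by rw [← hw, e']; ring
  · rw [weight_eq_zero hx hq hk] at hw ⊢
    rw [zero_mul] at hw
    simp only [zero_mul]
    linear_combination -(∏ i, qPoch q (a * x i) (k i) / qPoch q (c * x i) (k i)) *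
      (qPoch q b (∑ i, k i) / qPoch q D (∑ i, k i)) * q ^ (∑ i, k i) * (1 - D) * hw

lemma prod_neg_node (k : Fin n → ℕ) :
    ∏ j, (-node q x k j) = (∏ j, (-x j)) * q ^ ∑ i, k i := by
  rw [← prod_pow_sum, ← Finset.prod_mul_distrib]
  exact Finset.prod_congr rfl fun i _ => by simp [node]

/-- The recursion for the Pfaff–Saalschütz sum in the upper limits. -/
lemma sum_saalTerm_raise (m : Fin n) (h : Separated q x (raise N m))
    (hb : D * c * q ^ (∑ i, N i) = a * b)
    (hc : ∀ i, ∀ s < raise N m i, 1 - c * x i * q ^ s ≠ 0)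
    (hD : ∀ s < ∑ i, raise N m i, 1 - D * q ^ s ≠ 0) :
    (∑ k ∈ Iic (raise N m), saalTerm q x (raise N m) a b c D k) * (1 - D) *
        (1 - c * node q x N m) =
      (∑ k ∈ Iic N, saalTerm q x N a b c (D * q) k) *
        (b - D + a * node q x N m * (q ^ ∑ i, N i)⁻¹ - c * node q x N m) := by
  have hq := h.q_ne_zero
  set w := q * node q x N m with hw
  have hw0 : w ≠ 0 := mul_ne_zero hq (h.node_ne_zero N m)
  have hX : ∏ j, (w - x j) ≠ 0 := by
    have := prod_mul_node_sub_ne_zero h (k := N) le_rfl (l := 0) (fun i => (N i).zero_le)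
    rwa [node_zero] at this
  have hIic : ∑ k ∈ Iic N, saalTerm q x N a b c (D * q) k =
      ∑ k ∈ Iic (raise N m), saalTerm q x N a b c (D * q) k := by
    refine Finset.sum_subset (Iic_subset_Iic.2 (le_raise N m)) fun k _ hk => ?_
    rw [saalTerm, weight_eq_zero h.ne_zero hq (by simpa using hk)]
    simp
  have hsum : ∀ k ≤ raise N m, ∑ i, k i ≤ ∑ i, raise N m i := fun k hk =>
    Finset.sum_le_sum fun i _ => hk i
  have hleft : ∀ k ≤ raise N m, saalTerm q x N a b c (D * q) k * (1 - D * q ^ ∑ i, k i) *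
        ∏ i, (w - x i) =
      saalTerm q x (raise N m) a b c D k * (1 - D) * ∏ i, (w - node q x k i) := by
    intro k hk
    refine saalTerm_raise_left h.ne_zero hq k m (fun hkN => ?_) fun _ => ?_
    · rw [qPoch_ne_zero_iff]
      intro s hs
      have h1 : ∑ i, k i ≤ ∑ i, N i := Finset.sum_le_sum fun i _ => hkN i
      have := hD (s + 1) (by rw [sum_raise]; omega)
      rwa [pow_succ', ← mul_assoc] at this
    · rw [qPoch_ne_zero_iff]
      exact fun s hs => hD s (hs.trans_le (hsum k hk))
  let G : Fin n → (Fin n → ℕ) → ℂ := fun i k =>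
    saalTerm q x (raise N m) a b c D k * (1 - D) / (∏ j, (w - x j)) *
      ((∏ j, (node q x k i - x j)) * (1 - c / q * node q x k i) *
        (∏ j ∈ univ.erase i, (w - node q x k j)) /
        (node q x k i * ∏ j ∈ univ.erase i, (node q x k i - node q x k j)))
  let H : Fin n → (Fin n → ℕ) → ℂ := fun i k =>
    -(saalTerm q x N a b c (D * q) k * (1 - b * q ^ ∑ i, k i) / (q ^ (∑ i, N i) * q)) *
      ((∏ j ∈ univ.erase m, (node q x k i - node q x N j)) * (1 - a * node q x k i) /
        (node q x k i * ∏ j ∈ univ.erase i, (node q x k i - node q x k j)))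
  have hGH : ∀ i, ∑ k ∈ Iic (raise N m), H i k = ∑ k ∈ Iic (raise N m), G i k := by
    intro i
    apply sum_Iic_raise i
    · intro k hk hki
      have hk' : raise k i ≤ raise N m := by
        intro j
        by_cases hj : j = i
        · subst hj; rw [raise_self]; exact hki
        · rw [raise_of_ne k hj]; exact hk j
      have hc' : 1 - c * node q x k i ≠ 0 := by
        rw [node, ← mul_assoc]; exact hc i _ hki
      have hD' : 1 - D * q ^ ∑ i, k i ≠ 0 := by
        refine hD _ ?_
        have := hsum _ hk'
        rw [sum_raise k i] at this
        omega
      have h1 := saalTerm_raise (a := a) (b := b) h hk' hc' hD'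
      have h2 := hleft k hk
      have hA := prod_erase_ne_zero h hk i
      have hC : ∏ j ∈ univ.erase i, (q * node q x k i - node q x k j) ≠ 0 := by
        have := prod_erase_ne_zero h hk' i
        rw [node_raise_self] at this
        convert this using 2 with j hj
        rw [node_raise_of_ne k (ne_of_mem_erase hj)]
      have e1 : ∏ j, (node q x k i - node q x (raise N m) j) =
          (node q x k i - w) * ∏ j ∈ univ.erase m, (node q x k i - node q x N j) := by
        rw [← Finset.mul_prod_erase univ _ (mem_univ m), node_raise_self]
        congr 1
        exact Finset.prod_congr rfl fun j hj => by rw [node_raise_of_ne N (ne_of_mem_erase hj)]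
      have e2 : ∏ j ∈ univ.erase i, (w - node q x (raise k i) j) =
          ∏ j ∈ univ.erase i, (w - node q x k j) :=
        Finset.prod_congr rfl fun j hj => by rw [node_raise_of_ne k (ne_of_mem_erase hj)]
      have e3 : ∏ j ∈ univ.erase i, (q * node q x k i - node q x (raise k i) j) =
          ∏ j ∈ univ.erase i, (q * node q x k i - node q x k j) :=
        Finset.prod_congr rfl fun j hj => by rw [node_raise_of_ne k (ne_of_mem_erase hj)]
      rw [e1, sum_raise, pow_succ q (∑ i, N i)] at h1
      rw [← Finset.mul_prod_erase univ (fun j => w - node q x k j) (mem_univ i)] at h2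
      simp only [G, H, node_raise_self, e2, e3]
      have hz := h.node_ne_zero k i
      have hqM := pow_ne_zero (∑ i, N i) hq
      generalize ∏ j, (w - x j) = X at *
      generalize ∏ j ∈ univ.erase i, (q * node q x k i - node q x k j) = C at *
      generalize ∏ j ∈ univ.erase i, (node q x k i - node q x k j) = A at *
      generalize ∏ j ∈ univ.erase i, (w - node q x k j) = Z at *
      generalize ∏ j ∈ univ.erase m, (node q x k i - node q x N j) = Y at *
      generalize ∏ j, (q * node q x k i - x j) = B at *
      generalize saalTerm q x (raise N m) a b c D (raise k i) = t'' at *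
      generalize saalTerm q x (raise N m) a b c D k = t' at *
      generalize saalTerm q x N a b c (D * q) k = t at *
      generalize node q x k i = z at *
      generalize q ^ (∑ i, N i) = Q at *
      generalize q ^ (∑ i, k i) = R at *
      rw [show c / q * (q * z) = c * z by field_simp]
      rw [neg_mul, div_mul_div_comm, div_mul_div_comm, ← neg_div, div_eq_div_iff (by positivity)
        (by positivity)]
      apply mul_right_cancel₀ hD'
      linear_combination -(z * C * Y * (1 - a * z) * (1 - b * R) * q) * h2 -
        (1 - D) * Z * z * h1
    · intro k hk hki
      by_cases him : i = m
      · have : weight q x N k = 0 := by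
          refine weight_eq_zero h.ne_zero hq fun hkN => ?_
          have : k m ≤ N m := hkN m
          rw [him, raise_self] at hki
          omega
        simp [H, saalTerm, this]
      · have : ∏ j ∈ univ.erase m, (node q x k i - node q x N j) = 0 := by
          refine Finset.prod_eq_zero (mem_erase.2 ⟨him, mem_univ i⟩) ?_
          rw [raise_of_ne N him] at hki
          simp [node, hki]
        simp [H, this]
    · intro k _ hki
      have : ∏ j, (node q x k i - x j) = 0 :=
        Finset.prod_eq_zero (mem_univ i) (by simp [node, hki])
      simp [G, this]
  have hG : ∀ k ≤ raise N m, ∑ i, G i k = saalTerm q x (raise N m) a b c D k * (1 - D) *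
      (1 - c * node q x N m) / w + saalTerm q x N a b c (D * q) k * (1 - D * q ^ ∑ i, k i) *
        (c * node q x N m - (q ^ ∑ i, k i)⁻¹) / w := by
    intro k hk
    rw [← Finset.mul_sum, sum_prod_mul_prod_div_node (h.node_injective hk) (h.node_ne_zero k) _ _
      hw0, prod_neg_node]
    have hx : ∏ j, (-x j) ≠ 0 := Finset.prod_ne_zero_iff.2 fun j _ => neg_ne_zero.2 (h.ne_zero j)
    have h1 := hleft k hk
    have e1 : c / q * w = c * node q x N m := by rw [hw]; field_simp
    rw [← e1, div_mul_cancel_left₀ hx, ← add_div]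
    have hqK := pow_ne_zero (∑ i, k i) hq
    generalize ∏ j, (w - x j) = X at *
    field_simp
    linear_combination -q * (q ^ (∑ i, k i) * c * node q x N m - 1) * h1
  have hH : ∀ k ≤ raise N m, ∑ i, H i k =
      -(saalTerm q x N a b c (D * q) k * (1 - b * q ^ ∑ i, k i) / (q ^ (∑ i, N i) * q)) *
      (-a + q ^ (∑ i, N i) / (q ^ (∑ i, k i) * node q x N m)) := by
    intro k hk
    rw [← Finset.mul_sum, sum_prod_erase_div_node (h.node_injective hk) (h.node_ne_zero k),
      prod_neg_node]
    have hx : ∏ j, (-x j) ≠ 0 := Finset.prod_ne_zero_iff.2 fun j _ => neg_ne_zero.2 (h.ne_zero j)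
    have h1 : (-node q x N m) * ∏ j ∈ univ.erase m, (-node q x N j) =
        (∏ j, (-x j)) * q ^ ∑ i, N i := by
      rw [← prod_neg_node, ← Finset.mul_prod_erase univ _ (mem_univ m)]
    have hu := h.node_ne_zero N m
    have hqK := pow_ne_zero (∑ i, k i) hq
    congr 1
    rw [sub_eq_add_neg, ← neg_div]
    congr 1
    rw [div_eq_div_iff (by positivity) (by positivity)]
    linear_combination q ^ (∑ i, k i) * h1
  have hfin : ∑ k ∈ Iic (raise N m), ∑ i, G i k = ∑ k ∈ Iic (raise N m), ∑ i, H i k := by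
    rw [Finset.sum_comm, ← Finset.sum_congr rfl fun i _ => hGH i, Finset.sum_comm]
  rw [Finset.sum_congr rfl fun k hk => hG k (mem_Iic.1 hk),
    Finset.sum_congr rfl fun k hk => hH k (mem_Iic.1 hk), ← sub_eq_zero,
    ← Finset.sum_sub_distrib] at hfin
  rw [hIic, Finset.sum_mul, Finset.sum_mul, Finset.sum_mul, ← sub_eq_zero,
    ← Finset.sum_sub_distrib, ← mul_eq_zero_iff_right (inv_ne_zero hw0), Finset.sum_mul, ← hfin]
  refine Finset.sum_congr rfl fun k _ => ?_
  have hu := h.node_ne_zero N m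
  have hqM := pow_ne_zero (∑ i, N i) hq
  have hqK := pow_ne_zero (∑ i, k i) hq
  rw [hw]
  generalize saalTerm q x (raise N m) a b c D k = t'
  generalize saalTerm q x N a b c (D * q) k = t at *
  generalize node q x N m = u at *
  generalize q ^ (∑ i, N i) = Q at *
  generalize q ^ (∑ i, k i) = R at *
  field_simp
  linear_combination t * R ^ 2 * u * hb

/-- The `A_n` Pfaff–Saalschütz sum. -/
lemma sum_saalTerm (h : Separated q x N) (ha : a ≠ 0) (hb : b ≠ 0) (hc : c ≠ 0)
    (hcx : ∀ i, ∀ s < N i, 1 - c * x i * q ^ s ≠ 0)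
    (habc : ∀ s < ∑ i, N i, 1 - c / (a * b) * q ^ s ≠ 0)
    (hD : D * c * q ^ (∑ i, N i) = a * b * q) :
    ∑ k ∈ Iic N, saalTerm q x N a b c D k =
      qPoch q (c / a) (∑ i, N i) / qPoch q (c / (a * b)) (∑ i, N i) *
        ∏ i, qPoch q (c * x i / b) (N i) / qPoch q (c * x i) (N i) := by
  induction N using raise_induction generalizing D with
  | zero =>
    have h0 : Iic (0 : Fin n → ℕ) = {0} := by ext; simp
    simp [h0, saalTerm, weight_zero h, qPoch_zero]
  | raise N m ih =>
    have hq := h.q_ne_zero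
    have hcx' : ∀ i, ∀ s < N i, 1 - c * x i * q ^ s ≠ 0 :=
      fun i s hs => hcx i s (hs.trans_le (le_raise N m i))
    have h1 := ih (D := D * q) (h.mono (le_raise N m)) hcx'
      (fun s hs => habc s (by rw [sum_raise]; omega))
      (by rw [sum_raise, pow_succ] at hD; linear_combination hD)
    have hQ := pow_ne_zero (∑ i, N i) hq
    have hD' : D * c * q ^ (∑ i, N i) = a * b := by
      rw [sum_raise, pow_succ] at hD
      exact mul_right_cancel₀ hq (by linear_combination hD)
    have hrec := sum_saalTerm_raise m h hD' hcx fun s hs hs0 => by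
      rw [sum_raise] at hs
      refine habc (∑ i, N i - s) (by rw [sum_raise]; omega) ?_
      have h2 : q ^ (∑ i, N i) = q ^ (∑ i, N i - s) * q ^ s := by
        rw [← pow_add]; congr 1; omega
      rw [h2] at hD'
      have : a * b = c * q ^ (∑ i, N i - s) := by
        linear_combination -hD' - c * q ^ (∑ i, N i - s) * hs0
      rw [sub_eq_zero, div_mul_eq_mul_div, this, div_self]
      rw [← this]; positivity
    rw [h1] at hrec
    have h3 := prod_raise (fun i s => qPoch q (c * x i / b) s / qPoch q (c * x i) s) N m
      (r := (1 - c * node q x N m / b) / (1 - c * node q x N m)) (by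
        simp only [qPoch_succ, node]
        rw [mul_div_mul_comm]
        ring_nf)
    rw [h3, sum_raise, qPoch_succ, qPoch_succ, mul_div_mul_comm]
    have h4 : 1 - c * node q x N m ≠ 0 := by
      rw [node, ← mul_assoc]
      exact hcx m (N m) (by simp)
    have h5 : 1 - c / (a * b) * q ^ ∑ i, N i ≠ 0 := habc _ (by rw [sum_raise]; omega)
    have hDe : D = a * b / (c * q ^ ∑ i, N i) := by rw [← hD']; field_simp
    have h6 : (1 - D) * (c * q ^ (∑ i, N i)) = -(a * b) * (1 - c / (a * b) * q ^ ∑ i, N i) := by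
      rw [hDe]; field_simp; ring
    have h7 : (b - D + a * node q x N m * (q ^ ∑ i, N i)⁻¹ - c * node q x N m) *
        (c * q ^ (∑ i, N i)) =
        -(a * b) * (1 - c / a * q ^ ∑ i, N i) * (1 - c * node q x N m / b) := by
      rw [hDe]; field_simp; ring
    have hab : -(a * b) ≠ 0 := neg_ne_zero.2 (mul_ne_zero ha hb)
    generalize qPoch q (c / a) (∑ i, N i) / qPoch q (c / (a * b)) (∑ i, N i) = R at *
    generalize ∏ i, qPoch q (c * x i / b) (N i) / qPoch q (c * x i) (N i) = P at *
    generalize ∑ k ∈ Iic (raise N m), saalTerm q x (raise N m) a b c D k = S at *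
    apply mul_right_cancel₀ h4
    apply mul_right_cancel₀ h5
    apply mul_right_cancel₀ hab
    rw [show R * ((1 - c / a * q ^ ∑ i, N i) / (1 - c / (a * b) * q ^ ∑ i, N i)) *
        (P * ((1 - c * node q x N m / b) / (1 - c * node q x N m))) * (1 - c * node q x N m) *
        (1 - c / (a * b) * q ^ ∑ i, N i) * -(a * b) = R * P *
        (((1 - c / a * q ^ ∑ i, N i) / (1 - c / (a * b) * q ^ ∑ i, N i)) *
          (1 - c / (a * b) * q ^ ∑ i, N i)) *
        (((1 - c * node q x N m / b) / (1 - c * node q x N m)) * (1 - c * node q x N m)) *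
        -(a * b) by ring, div_mul_cancel₀ _ h5, div_mul_cancel₀ _ h4]
    linear_combination c * q ^ (∑ i, N i) * hrec - S * (1 - c * node q x N m) * h6 + R * P * h7

end Saalschutz

section Inversion

open Filter Topology

variable {q : ℂ} {n : ℕ} {x : Fin n → ℂ} {N : Fin n → ℕ} {a : ℂ}

/-- The lower triangular matrix of the `A_n` Bailey lemma. -/
noncomputable def baileyMatrix (q : ℂ) {n : ℕ} (x : Fin n → ℂ) (a : ℂ) (k j : Fin n → ℕ) : ℂ :=
  weight q x k j * (∏ i, qPoch q (a * x i * q ^ ∑ l, k l) (j i)) * q ^ ∑ l, j l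

/-- The very-well-poised lower triangular matrix, inverse to `baileyMatrix` up to scaling of
the rows. -/
noncomputable def wellPoisedMatrix (q : ℂ) {n : ℕ} (x : Fin n → ℂ) (a : ℂ) (N k : Fin n → ℕ) : ℂ :=
  weight q x N k * (∏ i, (1 - a * x i * q ^ (k i + ∑ l, k l)) *
    (qPoch q (a * x i) (∑ l, k l) / qPoch q (a * x i * q ^ (1 + N i)) (∑ l, k l))) *
    q ^ ((∑ l, N l) * ∑ l, k l)

lemma sum_Iic_eq_sum_add {j k : Fin n → ℕ} (hjk : j ≤ k) (hk : k ≤ N) {f : (Fin n → ℕ) → ℂ}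
    (hf : ∀ l, ¬ (j ≤ l ∧ l ≤ k) → f l = 0) :
    ∑ l ∈ Iic N, f l = ∑ m ∈ Iic (k - j), f (j + m) := by
  symm
  refine Finset.sum_of_injOn (fun m => j + m) (fun _ _ _ _ h => add_left_cancel h) ?_ ?_ ?_
  · intro m hm
    simp only [coe_Iic, Set.mem_Iic] at hm ⊢
    exact ((add_le_add_right hm j).trans_eq (add_tsub_cancel_of_le hjk)).trans hk
  · intro l _ hl
    refine hf l fun h => hl ⟨l - j, ?_, add_tsub_cancel_of_le h.1⟩
    simpa using tsub_le_tsub_right h.2 j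
  · intros; rfl

lemma sum_add_fun (j m : Fin n → ℕ) : ∑ i, (j + m) i = ∑ i, j i + ∑ i, m i :=
  Finset.sum_add_distrib

lemma baileyMatrix_mul_wellPoisedMatrix (h : Separated q x N)
    (ha : ∀ i, ∀ s ≤ N i + ∑ l, N l, 1 - a * x i * q ^ s ≠ 0) {j m : Fin n → ℕ} (hjm : j + m ≤ N) :
    baileyMatrix q x a N (j + m) * (wellPoisedMatrix q x a (j + m) j /
        ∏ i, qPoch q (a * x i) (j i + m i + 1)) =
      weight q x j j * weight q x N j * (∏ i, (1 - a * x i * q ^ (j i + ∑ l, j l)) *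
        qPoch q (a * x i) (∑ l, j l) * qPoch q (a * x i * q ^ ∑ l, N l) (j i) /
          qPoch q (a * x i) (j i + 1 + ∑ l, j l)) * q ^ (∑ l, j l + (∑ l, j l) * ∑ l, j l) *
      saalTerm q (node q x j) (N - j) (a * q ^ ∑ l, N l) q (a * q ^ (1 + ∑ l, j l)) q m := by
  have hw := weight_mul_weight h hjm
  have hq := h.q_ne_zero
  have h1 : qPoch q q (∑ l, m l) ≠ 0 := by
    rw [qPoch_ne_zero_iff]
    intro s _ hs
    exact h.q_pow_ne_one (s + 1) s.succ_pos (by rw [pow_succ']; linear_combination -hs)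
  have hJ : ∑ l, j l ≤ ∑ l, N l := Finset.sum_le_sum fun i _ => (le_self_add.trans hjm) i
  have hgen : ∀ i, ∀ s t, s + t ≤ N i + ∑ l, N l + 1 → qPoch q (a * x i * q ^ s) t ≠ 0 := by
    intro i s t hst
    rw [qPoch_ne_zero_iff]
    intro r hr
    rw [mul_assoc, ← pow_add]
    exact ha i _ (by omega)
  have key : ∀ i, qPoch q (a * x i * q ^ ∑ l, N l) ((j + m) i) *
      ((1 - a * x i * q ^ (j i + ∑ l, j l)) * (qPoch q (a * x i) (∑ l, j l) /
        qPoch q (a * x i * q ^ (1 + (j + m) i)) (∑ l, j l))) /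
          qPoch q (a * x i) (j i + m i + 1) =
      ((1 - a * x i * q ^ (j i + ∑ l, j l)) *
        qPoch q (a * x i) (∑ l, j l) * qPoch q (a * x i * q ^ ∑ l, N l) (j i) /
          qPoch q (a * x i) (j i + 1 + ∑ l, j l)) *
      (qPoch q (a * q ^ (∑ l, N l) * node q x j i) (m i) /
        qPoch q (a * q ^ (1 + ∑ l, j l) * node q x j i) (m i)) := by
    intro i
    have hi : j i + m i ≤ N i := hjm i
    have n1 := hgen i (1 + (j i + m i)) (∑ l, j l) (by omega)
    have n2 := hgen i 0 (j i + m i + 1) (by omega)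
    have n3 := hgen i 0 (j i + 1 + ∑ l, j l) (by omega)
    have n4 := hgen i (j i + 1 + ∑ l, j l) (m i) (by omega)
    have e1 := qPoch_add (q := q) (a := a * x i) (j i + m i + 1) (∑ l, j l)
    rw [show j i + m i + 1 + ∑ l, j l = (j i + 1 + ∑ l, j l) + m i by omega, qPoch_add] at e1
    have e2 := qPoch_add (q := q) (a := a * x i * q ^ ∑ l, N l) (j i) (m i)
    rw [pow_zero, mul_one] at n2 n3
    rw [Pi.add_apply, e2,
      show a * q ^ (∑ l, N l) * node q x j i = a * x i * q ^ (∑ l, N l) * q ^ j i by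
        rw [node]; ring,
      show a * q ^ (1 + ∑ l, j l) * node q x j i = a * x i * q ^ (j i + 1 + ∑ l, j l) by
        rw [node]; ring]
    rw [add_comm (j i + m i) 1] at e1 n2 ⊢
    field_simp
    linear_combination qPoch q (a * x i * q ^ ∑ l, N l) (j i) *
      qPoch q (a * x i * q ^ (∑ l, N l) * q ^ j i) (m i) * qPoch q (a * x i) (∑ l, j l) *
      (1 - a * x i * q ^ (j i + ∑ l, j l)) * e1
  have key' := Finset.prod_congr (rfl : (univ : Finset (Fin n)) = univ) fun i _ => key i
  rw [Finset.prod_div_distrib, Finset.prod_mul_distrib, Finset.prod_mul_distrib (f := fun i =>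
    (1 - a * x i * q ^ (j i + ∑ l, j l)) * qPoch q (a * x i) (∑ l, j l) *
      qPoch q (a * x i * q ^ ∑ l, N l) (j i) / qPoch q (a * x i) (j i + 1 + ∑ l, j l))] at key'
  unfold baileyMatrix wellPoisedMatrix saalTerm
  rw [div_self h1, sum_add_fun, mul_one]
  have hmul := congrArg₂ (· * ·) hw key'
  simp only at hmul
  linear_combination q ^ (∑ l, m l) * q ^ (∑ l, j l + (∑ l, j l) * ∑ l, j l) * hmul

/-- `baileyMatrix` is a left inverse of the normalized `wellPoisedMatrix`. -/
lemma sum_baileyMatrix_mul_wellPoisedMatrix (h : Separated q x N) (ha0 : a ≠ 0)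
    (ha : ∀ i, ∀ s ≤ N i + ∑ l, N l, 1 - a * x i * q ^ s ≠ 0) {j k : Fin n → ℕ} (hj : j ≤ N)
    (hk : k ≤ N) :
    ∑ l ∈ Iic N, baileyMatrix q x a k l * (wellPoisedMatrix q x a l j /
      ∏ i, qPoch q (a * x i) (l i + 1)) = if k = j then 1 else 0 := by
  have hq := h.q_ne_zero
  have hzero : ∀ l, ¬ (j ≤ l ∧ l ≤ k) → baileyMatrix q x a k l * (wellPoisedMatrix q x a l j /
      ∏ i, qPoch q (a * x i) (l i + 1)) = 0 := by
    intro l hl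
    rcases not_and_or.1 hl with hl | hl
    · simp [wellPoisedMatrix, weight_eq_zero h.ne_zero hq hl]
    · simp [baileyMatrix, weight_eq_zero h.ne_zero hq hl]
  by_cases hjk : j ≤ k
  · rw [sum_Iic_eq_sum_add hjk hk hzero]
    have hsum : ∑ l, k l ≤ ∑ l, N l := Finset.sum_le_sum fun i _ => hk i
    have hJ := sum_sub_add k hjk
    have hak : ∀ i, ∀ s ≤ k i + ∑ l, k l, 1 - a * x i * q ^ s ≠ 0 := fun i s hs =>
      ha i s (hs.trans (add_le_add (hk i) hsum))
    have hjm : ∀ m ∈ Iic (k - j), j + m ≤ k := fun m hm =>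
      (add_le_add_right (mem_Iic.1 hm) j).trans_eq (add_tsub_cancel_of_le hjk)
    have hterm := Finset.sum_congr (rfl : Iic (k - j) = Iic (k - j)) fun m hm =>
      baileyMatrix_mul_wellPoisedMatrix (h.mono hk) hak (hjm m hm)
    refine hterm.trans ?_
    have hqn : ∀ s : ℕ, 0 < s → 1 - q ^ s ≠ 0 := fun s hs =>
      sub_ne_zero.2 (h.q_pow_ne_one s hs).symm
    have hpow : ∀ s, q ^ s ≠ 0 := fun s => pow_ne_zero s hq
    rw [← Finset.mul_sum, sum_saalTerm ((h.mono hk).shift hjk) (mul_ne_zero ha0 (hpow _)) hq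
      (mul_ne_zero ha0 (hpow _))]
    · by_cases hkj : k = j
      · subst hkj
        have hw := weight_self (h.mono hk)
        have h2 : ∏ i, (1 - a * x i * q ^ (k i + ∑ l, k l)) * qPoch q (a * x i) (∑ l, k l) *
            qPoch q (a * x i * q ^ ∑ l, k l) (k i) /
              qPoch q (a * x i) (k i + 1 + ∑ l, k l) = 1 := by
          refine Finset.prod_eq_one fun i _ => ?_
          have h3 : qPoch q (a * x i) (k i + 1 + ∑ l, k l) ≠ 0 := by
            rw [qPoch_ne_zero_iff]
            exact fun s hs => hak i s (by omega)
          rw [div_eq_one_iff_eq h3, show k i + 1 + ∑ l, k l = (∑ l, k l + k i) + 1 by ring,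
            qPoch_succ, qPoch_add]
          ring
        have h4 : (∑ l, k l + 1).choose 2 + (∑ l, k l + 1).choose 2 =
            ∑ l, k l + (∑ l, k l) * ∑ l, k l := by
          have h5 := Nat.choose_two_right (∑ l, k l + 1)
          have h6 := Nat.div_two_mul_two_of_even (Nat.even_mul_pred_self (∑ l, k l + 1))
          rw [← h5, Nat.add_sub_cancel] at h6
          linarith
        simp only [tsub_self, Pi.zero_apply, Finset.sum_const_zero, qPoch_zero, div_one, h2,
          Finset.prod_const_one, mul_one, if_true]
        rw [← h4, pow_add]
        calc _ = (weight q x k k * q ^ (∑ i, k i + 1).choose 2) *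
              (weight q x k k * q ^ (∑ i, k i + 1).choose 2) := by ring
          _ = 1 := by rw [hw, ← mul_pow]; simp
      · have h2 : 0 < ∑ l, (k - j) l := by
          refine Nat.pos_of_ne_zero fun h0 => hkj (le_antisymm ?_ hjk)
          rw [← tsub_eq_zero_iff_le]
          funext i
          exact Finset.sum_eq_zero_iff.1 h0 i (mem_univ i)
        have h3 : qPoch q (a * q ^ (1 + ∑ l, j l) / (a * q ^ ∑ l, k l)) (∑ l, (k - j) l) = 0 := by
          by_contra h3
          rw [← ne_eq, qPoch_ne_zero_iff] at h3
          refine h3 (∑ l, (k - j) l - 1) (by omega) ?_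
          have e : ∑ l, k l = (1 + ∑ l, j l) + (∑ l, (k - j) l - 1) := by omega
          rw [e, pow_add q (1 + ∑ l, j l)]
          have := hpow (1 + ∑ l, j l)
          have := hpow (∑ l, (k - j) l - 1)
          field_simp
          ring
        rw [h3, if_neg hkj]
        ring
    · intro i s hs
      have hs' : s < k i - j i := hs
      rw [node, show a * q ^ (1 + ∑ l, j l) * (x i * q ^ j i) * q ^ s =
        a * x i * q ^ (1 + ∑ l, j l + j i + s) by ring]
      exact hak i _ (by omega)
    · intro s hs h0
      refine hqn (∑ l, (k - j) l - s) (by omega) ?_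
      have e : q ^ (∑ l, k l) = q ^ (∑ l, j l) * (q ^ (∑ l, (k - j) l - s) * q ^ s) := by
        rw [← pow_add, ← pow_add]; congr 1; omega
      rw [e] at h0
      have := hpow s
      have := hpow (∑ l, j l)
      have := hpow (∑ l, (k - j) l - s)
      field_simp at h0
      rw [pow_add] at h0
      field_simp at h0
      linear_combination -h0
    · rw [← hJ, pow_add, pow_add]; ring
  · rw [if_neg (by rintro rfl; exact hjk le_rfl)]
    refine Finset.sum_eq_zero fun l _ => hzero l fun hl => hjk (hl.1.trans hl.2)

lemma sum_wellPoisedMatrix_mul_baileyMatrix_of_generic (h : Separated q x N) (ha0 : a ≠ 0)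
    (ha : ∀ i, ∀ s ≤ N i + ∑ l, N l, 1 - a * x i * q ^ s ≠ 0) {j : Fin n → ℕ} (hj : j ≤ N) :
    ∑ k ∈ Iic N, wellPoisedMatrix q x a N k * baileyMatrix q x a k j =
      if j = N then ∏ i, qPoch q (a * x i) (N i + 1) else 0 := by
  let A : Matrix (Iic N) (Iic N) ℂ := fun k l => baileyMatrix q x a k l
  let B : Matrix (Iic N) (Iic N) ℂ := fun l j => wellPoisedMatrix q x a l j /
    ∏ i, qPoch q (a * x i) ((l : Fin n → ℕ) i + 1)
  have hAB : A * B = 1 := by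
    ext ⟨k, hk⟩ ⟨j, hj⟩
    rw [Matrix.mul_apply, Matrix.one_apply]
    simp only [Subtype.mk.injEq, A, B]
    rw [← sum_baileyMatrix_mul_wellPoisedMatrix h ha0 ha (mem_Iic.1 hj) (mem_Iic.1 hk)]
    exact Finset.sum_coe_sort (Iic N) fun l => baileyMatrix q x a k l *
      (wellPoisedMatrix q x a l j / ∏ i, qPoch q (a * x i) (l i + 1))
  have hBA : (B * A) ⟨N, mem_Iic.2 le_rfl⟩ ⟨j, mem_Iic.2 hj⟩ =
      (1 : Matrix (Iic N) (Iic N) ℂ) ⟨N, mem_Iic.2 le_rfl⟩ ⟨j, mem_Iic.2 hj⟩ := by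
    rw [mul_eq_one_comm.1 hAB]
  rw [Matrix.mul_apply, Matrix.one_apply] at hBA
  simp only [Subtype.mk.injEq, A, B] at hBA
  rw [Finset.sum_coe_sort (Iic N) fun k => wellPoisedMatrix q x a N k /
    (∏ i, qPoch q (a * x i) (N i + 1)) * baileyMatrix q x a k j] at hBA
  have hτ : ∏ i, qPoch q (a * x i) (N i + 1) ≠ 0 := by
    refine Finset.prod_ne_zero_iff.2 fun i _ => ?_
    rw [qPoch_ne_zero_iff]
    exact fun s hs => ha i s (by omega)
  calc _ = (∏ i, qPoch q (a * x i) (N i + 1)) * ∑ k ∈ Iic N, wellPoisedMatrix q x a N k /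
        (∏ i, qPoch q (a * x i) (N i + 1)) * baileyMatrix q x a k j := by
        rw [Finset.mul_sum]
        refine Finset.sum_congr rfl fun k _ => ?_
        field_simp
    _ = _ := by
        rw [hBA, mul_ite, mul_one, mul_zero]
        simp only [eq_comm]

lemma continuous_qPoch {f : ℂ → ℂ} (hf : Continuous f) (k : ℕ) :
    Continuous fun a => qPoch q (f a) k := by
  unfold qPoch
  fun_prop

lemma eventually_one_sub_mul_ne_zero (a y : ℂ) :
    ∀ᶠ t in 𝓝[≠] a, 1 - t * y ≠ 0 := by
  have h : ∀ᶠ t in 𝓝[≠] a, t ≠ y⁻¹ := by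
    by_cases hay : a = y⁻¹
    · exact hay ▸ self_mem_nhdsWithin
    · exact (eventually_ne_nhds hay).filter_mono nhdsWithin_le_nhds
  filter_upwards [h] with t ht h0
  exact ht (eq_inv_of_mul_eq_one_left (by linear_combination -h0))

/-- Up to scaling of the rows, `wellPoisedMatrix` is a left inverse of `baileyMatrix`. -/
lemma sum_wellPoisedMatrix_mul_baileyMatrix (h : Separated q x N) (ha0 : a ≠ 0)
    (ha : ∀ i, ∀ s < ∑ l, N l, 1 - a * x i * q ^ (1 + N i) * q ^ s ≠ 0) {j : Fin n → ℕ}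
    (hj : j ≤ N) :
    ∑ k ∈ Iic N, wellPoisedMatrix q x a N k * baileyMatrix q x a k j =
      if j = N then ∏ i, qPoch q (a * x i) (N i + 1) else 0 := by
  have hev : ∀ᶠ t in 𝓝[≠] a, ∑ k ∈ Iic N, wellPoisedMatrix q x t N k * baileyMatrix q x t k j =
      if j = N then ∏ i, qPoch q (t * x i) (N i + 1) else 0 := by
    have h1 : ∀ᶠ t in 𝓝[≠] a, ∀ i, ∀ s ∈ Iic (N i + ∑ l, N l), 1 - t * (x i * q ^ s) ≠ 0 := by
      rw [eventually_all]
      intro i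
      rw [Finset.eventually_all]
      exact fun s _ => eventually_one_sub_mul_ne_zero a _
    have h2 : ∀ᶠ t in 𝓝[≠] a, t ≠ 0 := (eventually_ne_nhds ha0).filter_mono nhdsWithin_le_nhds
    filter_upwards [h1, h2] with t ht ht0
    refine sum_wellPoisedMatrix_mul_baileyMatrix_of_generic h ht0 (fun i s hs => ?_) hj
    rw [mul_assoc]
    exact ht i s (mem_Iic.2 hs)
  have hl : ContinuousAt (fun t => ∑ k ∈ Iic N, wellPoisedMatrix q x t N k *
      baileyMatrix q x t k j) a := by
    refine tendsto_finsetSum _ fun k hk => ContinuousAt.mul ?_ ?_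
    · unfold wellPoisedMatrix
      refine ((continuousAt_const).mul (tendsto_finsetProd _ fun i _ => ?_)).mul continuousAt_const
      refine ContinuousAt.mul (by fun_prop) (ContinuousAt.div
        (continuous_qPoch (by fun_prop) _).continuousAt
        (continuous_qPoch (by fun_prop) _).continuousAt ?_)
      rw [qPoch_ne_zero_iff]
      exact fun s hs => ha i s (hs.trans_le (Finset.sum_le_sum fun i _ => mem_Iic.1 hk i))
    · unfold baileyMatrix
      refine ((continuousAt_const).mul (tendsto_finsetProd _ fun i _ => ?_)).mul continuousAt_const
      exact (continuous_qPoch (by fun_prop) _).continuousAt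
  have hr : ContinuousAt (fun t => if j = N then ∏ i, qPoch q (t * x i) (N i + 1) else 0) a := by
    split_ifs
    · exact tendsto_finsetProd _ fun i _ => (continuous_qPoch (by fun_prop) _).continuousAt
    · exact continuousAt_const
  exact tendsto_nhds_unique_of_eventuallyEq (hl.tendsto.mono_left nhdsWithin_le_nhds)
    (hr.tendsto.mono_left nhdsWithin_le_nhds) hev

end Inversion

section Bailey

variable {q : ℂ} {n : ℕ} {x : Fin n → ℂ} {N : Fin n → ℕ} {a b d : ℂ}

lemma qPoch_reverse {y z : ℂ} {K : ℕ} (hq : q ≠ 0) (h : y * z * q ^ K = q) :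
    qPoch q y K = qPoch q z K * ((-y) ^ K * q ^ K.choose 2) := by
  have h1 : ∏ i ∈ range K, (-y * q ^ i) = (-y) ^ K * q ^ K.choose 2 := by
    rw [Finset.prod_mul_distrib, Finset.prod_const, card_range, Finset.prod_pow_eq_pow_sum,
      Finset.sum_range_id, Nat.choose_two_right]
  rw [← h1, qPoch, qPoch, ← Finset.prod_range_reflect (fun i => 1 - z * q ^ i),
    ← Finset.prod_mul_distrib]
  refine Finset.prod_congr rfl fun i hi => ?_
  have hi := mem_range.1 hi
  have h2 : y * z * (q ^ (K - 1 - i) * q ^ i) = 1 := by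
    rw [← pow_add, show K - 1 - i + i = K - 1 by omega]
    refine mul_right_cancel₀ hq ?_
    rw [mul_assoc, ← pow_succ, show K - 1 + 1 = K by omega, h, one_mul]
  linear_combination -h2

/-- The well-poised half of a pair related by `baileyMatrix`. -/
noncomputable def wellPoisedFactor (q : ℂ) {n : ℕ} (x : Fin n → ℂ) (a b d : ℂ) (k : Fin n → ℕ) :
    ℂ :=
  qPoch q d (∑ i, k i) / qPoch q (a * q / b) (∑ i, k i) *
    (∏ i, qPoch q (b * x i) (k i) / qPoch q (a * x i * q / d) (k i)) *
    (a * q / (b * d)) ^ ∑ i, k i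

/-- The balanced half of a pair related by `baileyMatrix`. -/
noncomputable def balancedFactor (q : ℂ) {n : ℕ} (x : Fin n → ℂ) (a b d : ℂ) (j : Fin n → ℕ) : ℂ :=
  qPoch q (a * q / (b * d)) (∑ i, j i) /
    (qPoch q (a * q / b) (∑ i, j i) * ∏ i, qPoch q (a * x i * q / d) (j i))

lemma sum_baileyMatrix_mul_balancedFactor (h : Separated q x N) (ha : a ≠ 0) (hb : b ≠ 0)
    (hd : d ≠ 0) (hdx : ∀ i, ∀ s < N i, 1 - a * x i * q / d * q ^ s ≠ 0)
    (hbK : ∀ s < ∑ i, N i, 1 - a * q / b * q ^ s ≠ 0) {k : Fin n → ℕ} (hk : k ≤ N) :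
    ∑ j ∈ Iic N, baileyMatrix q x a k j * balancedFactor q x a b d j =
      wellPoisedFactor q x a b d k := by
  have hq := h.q_ne_zero
  have hK := pow_ne_zero (∑ i, k i) hq
  have hle : ∑ i, k i ≤ ∑ i, N i := Finset.sum_le_sum fun i _ => hk i
  have h1 := sum_saalTerm (a := a * q ^ ∑ i, k i) (b := a * q / (b * d)) (c := a * q / d)
    (D := a * q / b) (h.mono hk) (by positivity) (by positivity) (by positivity)
    (fun i s hs => by
      rw [show a * q / d * x i = a * x i * q / d by ring]
      exact hdx i s (hs.trans_le (hk i)))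
    (fun s hs h0 => by
      refine hbK (∑ i, k i - s - 1) (by omega) ?_
      rw [show ∑ i, k i = (∑ i, k i - s - 1) + 1 + s by omega, pow_add, pow_succ] at h0
      have := pow_ne_zero s hq
      have := pow_ne_zero (∑ i, k i - s - 1) hq
      field_simp at h0 ⊢
      linear_combination -h0)
    (by field_simp)
  have hsub : ∑ j ∈ Iic N, baileyMatrix q x a k j * balancedFactor q x a b d j =
      ∑ j ∈ Iic k, baileyMatrix q x a k j * balancedFactor q x a b d j := by
    refine (Finset.sum_subset (Iic_subset_Iic.2 hk) fun j _ hj => ?_).symm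
    simp [baileyMatrix, weight_eq_zero h.ne_zero hq (mt mem_Iic.2 hj)]
  have hy := qPoch_reverse (y := a * q / d / (a * q ^ ∑ i, k i)) (z := d) (K := ∑ i, k i) hq
    (by field_simp)
  have hy' := qPoch_reverse (y := a * q / d / (a * q ^ (∑ i, k i) * (a * q / (b * d))))
    (z := a * q / b) (K := ∑ i, k i) hq (by field_simp)
  rw [hsub]
  refine (Finset.sum_congr rfl fun j _ => ?_).trans (h1.trans ?_)
  · unfold baileyMatrix balancedFactor saalTerm
    have e1 : ∏ i, qPoch q (a * q ^ (∑ i, k i) * x i) (j i) / qPoch q (a * q / d * x i) (j i) =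
        (∏ i, qPoch q (a * x i * q ^ ∑ l, k l) (j i)) /
          ∏ i, qPoch q (a * x i * q / d) (j i) := by
      rw [← Finset.prod_div_distrib]
      refine Finset.prod_congr rfl fun i _ => ?_
      ring_nf
    rw [e1]
    ring
  · rw [hy, hy']
    have e1 : ∏ i, qPoch q (a * q / d * x i / (a * q / (b * d))) (k i) /
        qPoch q (a * q / d * x i) (k i) =
        ∏ i, qPoch q (b * x i) (k i) / qPoch q (a * x i * q / d) (k i) := by
      refine Finset.prod_congr rfl fun i _ => ?_
      rw [show a * q / d * x i / (a * q / (b * d)) = b * x i by field_simp,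
        show a * q / d * x i = a * x i * q / d by ring]
    rw [e1, wellPoisedFactor, mul_div_mul_comm, mul_div_mul_right _ _ (by positivity), ← div_pow,
      neg_div_neg_eq]
    rw [show a * q / d / (a * q ^ (∑ i, k i)) /
      (a * q / d / (a * q ^ (∑ i, k i) * (a * q / (b * d)))) = a * q / (b * d) by field_simp]
    ring

/-- The terminating very-well-poised `₆φ₅` sum. -/
lemma sum_wellPoisedMatrix_mul_wellPoisedFactor (h : Separated q x N) (ha : a ≠ 0) (hb : b ≠ 0)
    (hd : d ≠ 0) (hax : ∀ i, ∀ s < ∑ l, N l, 1 - a * x i * q ^ (1 + N i) * q ^ s ≠ 0)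
    (hdx : ∀ i, ∀ s < N i, 1 - a * x i * q / d * q ^ s ≠ 0)
    (hbK : ∀ s < ∑ i, N i, 1 - a * q / b * q ^ s ≠ 0) :
    ∑ k ∈ Iic N, wellPoisedMatrix q x a N k * wellPoisedFactor q x a b d k =
      (∏ i, qPoch q (a * x i) (N i + 1)) * balancedFactor q x a b d N := by
  calc _ = ∑ k ∈ Iic N, ∑ j ∈ Iic N, wellPoisedMatrix q x a N k * baileyMatrix q x a k j *
        balancedFactor q x a b d j := by
        refine Finset.sum_congr rfl fun k hk => ?_
        rw [← sum_baileyMatrix_mul_balancedFactor h ha hb hd hdx hbK (mem_Iic.1 hk),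
          Finset.mul_sum]
        exact Finset.sum_congr rfl fun j _ => (mul_assoc _ _ _).symm
    _ = ∑ j ∈ Iic N, (if j = N then ∏ i, qPoch q (a * x i) (N i + 1) else 0) *
        balancedFactor q x a b d j := by
        rw [Finset.sum_comm]
        refine Finset.sum_congr rfl fun j hj => ?_
        rw [← Finset.sum_mul, sum_wellPoisedMatrix_mul_baileyMatrix h ha hax (mem_Iic.1 hj)]
    _ = _ := by simp [ite_mul]

end Bailey

section Watson

variable {q : ℂ} {n : ℕ} {x : Fin n → ℂ} {N : Fin n → ℕ} {a b c d e : ℂ}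

lemma wellPoisedFactor_add (hq : q ≠ 0) (j m : Fin n → ℕ) :
    wellPoisedFactor q x a b d (j + m) = wellPoisedFactor q x a b d j *
      wellPoisedFactor q (node q x j) (a * q ^ ∑ i, j i) b (d * q ^ ∑ i, j i) m := by
  have hJ := pow_ne_zero (∑ i, j i) hq
  have e1 : ∏ i, qPoch q (b * x i) ((j + m) i) / qPoch q (a * x i * q / d) ((j + m) i) =
      (∏ i, qPoch q (b * x i) (j i) / qPoch q (a * x i * q / d) (j i)) *
        ∏ i, qPoch q (b * node q x j i) (m i) /
          qPoch q (a * q ^ (∑ i, j i) * node q x j i * q / (d * q ^ ∑ i, j i)) (m i) := by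
    rw [← Finset.prod_mul_distrib]
    refine Finset.prod_congr rfl fun i _ => ?_
    rw [Pi.add_apply, qPoch_add, qPoch_add, mul_div_mul_comm,
      show a * q ^ (∑ i, j i) * node q x j i * q / (d * q ^ ∑ i, j i) =
        a * x i * q / d * q ^ j i by
          rw [show a * q ^ (∑ i, j i) * node q x j i * q =
            (a * node q x j i * q) * q ^ ∑ i, j i by ring, mul_div_mul_right _ _ hJ, node]
          ring]
    rw [node, mul_assoc b]
  unfold wellPoisedFactor
  rw [e1, sum_add_fun, qPoch_add, qPoch_add, pow_add,
    show a * q ^ (∑ i, j i) * q / b = a * q / b * q ^ ∑ i, j i by ring,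
    show a * q ^ (∑ i, j i) * q / (b * (d * q ^ ∑ i, j i)) = a * q / (b * d) by
      rw [show a * q ^ (∑ i, j i) * q = (a * q) * q ^ ∑ i, j i by ring, ← mul_assoc b,
        mul_div_mul_right _ _ hJ]]
  ring

lemma wellPoisedFactor_mul_balancedFactor (hq : q ≠ 0) {j : Fin n → ℕ} (hj : j ≤ N) :
    wellPoisedFactor q x a b d j *
        balancedFactor q (node q x j) (a * q ^ ∑ i, j i) b (d * q ^ ∑ i, j i) (N - j) =
      qPoch q d (∑ i, j i) * (∏ i, qPoch q (b * x i) (j i)) *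
        (qPoch q (a * q / (b * d)) (∑ i, (N - j) i) * (a * q / (b * d)) ^ ∑ i, j i) /
          (qPoch q (a * q / b) (∑ i, N i) * ∏ i, qPoch q (a * x i * q / d) (N i)) := by
  have hJ := pow_ne_zero (∑ i, j i) hq
  have e1 : ∏ i, qPoch q (a * x i * q / d) (N i) = (∏ i, qPoch q (a * x i * q / d) (j i)) *
      ∏ i, qPoch q (a * q ^ (∑ i, j i) * node q x j i * q / (d * q ^ ∑ i, j i)) ((N - j) i) := by
    rw [← Finset.prod_mul_distrib]
    refine Finset.prod_congr rfl fun i _ => ?_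
    rw [show a * q ^ (∑ i, j i) * node q x j i * q / (d * q ^ ∑ i, j i) =
        a * x i * q / d * q ^ j i by
          rw [show a * q ^ (∑ i, j i) * node q x j i * q =
            (a * node q x j i * q) * q ^ ∑ i, j i by ring, mul_div_mul_right _ _ hJ, node]
          ring, ← qPoch_add, Pi.sub_apply, Nat.add_sub_cancel' (hj i)]
  have e2 : qPoch q (a * q / b) (∑ i, N i) = qPoch q (a * q / b) (∑ i, j i) *
      qPoch q (a * q / b * q ^ ∑ i, j i) (∑ i, (N - j) i) := by
    rw [← qPoch_add, add_comm, sum_sub_add N hj]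
  unfold wellPoisedFactor balancedFactor
  rw [e1, e2, Finset.prod_div_distrib,
    show a * q ^ (∑ i, j i) * q / b = a * q / b * q ^ ∑ i, j i by ring,
    show a * q ^ (∑ i, j i) * q / (b * (d * q ^ ∑ i, j i)) = a * q / (b * d) by
      rw [show a * q ^ (∑ i, j i) * q = (a * q) * q ^ ∑ i, j i by ring, ← mul_assoc b,
        mul_div_mul_right _ _ hJ]]
  simp only [div_eq_mul_inv, mul_inv]
  ring

lemma wellPoisedMatrix_mul_baileyMatrix (h : Separated q x N) {j m : Fin n → ℕ}
    (hjm : j + m ≤ N) :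
    wellPoisedMatrix q x a N (j + m) * baileyMatrix q x a (j + m) j =
      weight q x j j * weight q x N j * (∏ i, qPoch q (a * x i) (∑ l, j l + j i) /
        qPoch q (a * x i * q ^ (1 + N i)) (∑ l, j l)) *
        q ^ (∑ l, j l + (∑ l, N l) * ∑ l, j l) *
      wellPoisedMatrix q (node q x j) (a * q ^ ∑ l, j l) (N - j) m := by
  have hw := weight_mul_weight h hjm
  have hj : j ≤ N := le_self_add.trans hjm
  have hN := sum_sub_add N hj
  have key : ∀ i, (1 - a * x i * q ^ ((j + m) i + ∑ l, (j + m) l)) *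
      (qPoch q (a * x i) (∑ l, (j + m) l) /
        qPoch q (a * x i * q ^ (1 + N i)) (∑ l, (j + m) l)) *
      qPoch q (a * x i * q ^ ∑ l, (j + m) l) (j i) =
      qPoch q (a * x i) (∑ l, j l + j i) / qPoch q (a * x i * q ^ (1 + N i)) (∑ l, j l) *
      ((1 - a * q ^ (∑ l, j l) * node q x j i * q ^ (m i + ∑ l, m l)) *
        (qPoch q (a * q ^ (∑ l, j l) * node q x j i) (∑ l, m l) /
          qPoch q (a * q ^ (∑ l, j l) * node q x j i * q ^ (1 + (N - j) i)) (∑ l, m l))) := by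
    intro i
    have e0 : a * q ^ (∑ l, j l) * node q x j i = a * x i * q ^ (∑ l, j l + j i) := by
      rw [node]; ring
    have hi : j i + (N - j) i = N i := Nat.add_sub_cancel' (hj i)
    have e1 := qPoch_add q (a * x i) (∑ l, j l + ∑ l, m l) (j i)
    rw [show ∑ l, j l + ∑ l, m l + j i = (∑ l, j l + j i) + ∑ l, m l by omega, qPoch_add] at e1
    rw [e0, sum_add_fun, qPoch_add q (a * x i * q ^ (1 + N i)),
      show a * x i * q ^ (∑ l, j l + j i) * q ^ (1 + (N - j) i) =
        a * x i * q ^ (1 + N i) * q ^ ∑ l, j l by rw [← hi]; ring,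
      show a * x i * q ^ (∑ l, j l + j i) * q ^ (m i + ∑ l, m l) =
        a * x i * q ^ ((j + m) i + (∑ l, j l + ∑ l, m l)) by rw [Pi.add_apply]; ring]
    simp only [div_eq_mul_inv, mul_inv]
    linear_combination (-(1 - a * x i * q ^ ((j + m) i + (∑ l, j l + ∑ l, m l))) *
      (qPoch q (a * x i * q ^ (1 + N i)) (∑ l, j l))⁻¹ *
      (qPoch q (a * x i * q ^ (1 + N i) * q ^ ∑ l, j l) (∑ l, m l))⁻¹) * e1
  have key' := Finset.prod_congr (rfl : (univ : Finset (Fin n)) = univ) fun i _ => key i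
  rw [Finset.prod_mul_distrib, Finset.prod_mul_distrib (f := fun i =>
    qPoch q (a * x i) (∑ l, j l + j i) / qPoch q (a * x i * q ^ (1 + N i)) (∑ l, j l))] at key'
  have hpow : q ^ ((∑ l, N l) * ∑ l, (j + m) l) = q ^ ((∑ l, j l) * ∑ l, m l) *
      (q ^ ((∑ l, N l) * ∑ l, j l) * q ^ ((∑ l, (N - j) l) * ∑ l, m l)) := by
    rw [← pow_add, ← pow_add, sum_add_fun]
    congr 1
    rw [← hN]
    ring
  unfold baileyMatrix wellPoisedMatrix
  rw [hpow, pow_add q (∑ l, j l)]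
  have hmul := congrArg₂ (· * ·) hw key'
  simp only at hmul
  linear_combination q ^ (∑ l, j l) * q ^ ((∑ l, N l) * ∑ l, j l) *
    q ^ ((∑ l, (N - j) l) * ∑ l, m l) * hmul

lemma sum_wellPoisedMatrix_mul_baileyMatrix_mul_wellPoisedFactor (h : Separated q x N) (ha : a ≠ 0)
    (hb : b ≠ 0) (hd : d ≠ 0)
    (hax : ∀ i, ∀ s < ∑ l, N l, 1 - a * x i * q ^ (1 + N i) * q ^ s ≠ 0)
    (hdx : ∀ i, ∀ s < N i, 1 - a * x i * q / d * q ^ s ≠ 0)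
    (hbK : ∀ s < ∑ i, N i, 1 - a * q / b * q ^ s ≠ 0) {y : ℂ}
    (hy : y * (a * q / (b * d)) * q ^ (∑ i, N i) = q) (hyK : ∀ s < ∑ i, N i, 1 - y * q ^ s ≠ 0)
    {j : Fin n → ℕ} (hj : j ≤ N) :
    ∑ k ∈ Iic N, wellPoisedMatrix q x a N k * baileyMatrix q x a k j *
        wellPoisedFactor q x a b d k =
      (∏ i, qPoch q (a * x i) (N i + 1)) * balancedFactor q x a b d N *
        (weight q x N j * (∏ i, qPoch q (b * x i) (j i)) *
          (qPoch q d (∑ i, j i) / qPoch q y (∑ i, j i)) * q ^ ∑ i, j i) := by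
  have hq := h.q_ne_zero
  have hJ := pow_ne_zero (∑ i, j i) hq
  have hN := sum_sub_add N hj
  rw [sum_Iic_eq_sum_add hj le_rfl fun l hl => ?_]
  swap
  · rcases not_and_or.1 hl with hl | hl
    · simp [baileyMatrix, weight_eq_zero h.ne_zero hq hl]
    · simp [wellPoisedMatrix, weight_eq_zero h.ne_zero hq hl]
  have h1 := sum_wellPoisedMatrix_mul_wellPoisedFactor (a := a * q ^ ∑ i, j i) (b := b)
    (d := d * q ^ ∑ i, j i) (h.shift hj) (mul_ne_zero ha hJ) hb (mul_ne_zero hd hJ)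
    (fun i s hs => by
      have hi : j i + (N - j) i = N i := Nat.add_sub_cancel' (hj i)
      rw [show a * q ^ (∑ i, j i) * node q x j i * q ^ (1 + (N - j) i) * q ^ s =
        a * x i * q ^ (1 + N i) * q ^ (∑ i, j i + s) by rw [← hi, node]; ring]
      exact hax i _ (by omega))
    (fun i s hs => by
      have hs' : s < N i - j i := hs
      rw [show a * q ^ (∑ i, j i) * node q x j i * q / (d * q ^ ∑ i, j i) * q ^ s =
        a * x i * q / d * q ^ (j i + s) by rw [node]; field_simp; ring]
      exact hdx i _ (by omega))
    (fun s hs => by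
      rw [show a * q ^ (∑ i, j i) * q / b * q ^ s = a * q / b * q ^ (∑ i, j i + s) by ring]
      exact hbK _ (by omega))
  have h2 : ∏ i, qPoch q (a * x i) (N i + 1) =
      (∏ i, qPoch q (a * x i) (∑ l, j l + j i) /
        qPoch q (a * x i * q ^ (1 + N i)) (∑ l, j l)) *
      ∏ i, qPoch q (a * q ^ (∑ i, j i) * node q x j i) ((N - j) i + 1) := by
    rw [← Finset.prod_mul_distrib]
    refine Finset.prod_congr rfl fun i _ => ?_
    have hi : j i + (N - j) i = N i := Nat.add_sub_cancel' (hj i)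
    have h3 : qPoch q (a * x i * q ^ (1 + N i)) (∑ l, j l) ≠ 0 := by
      rw [qPoch_ne_zero_iff]
      exact fun s hs => hax i s (by omega)
    rw [div_mul_eq_mul_div, eq_div_iff h3, show a * q ^ (∑ i, j i) * node q x j i =
      a * x i * q ^ (∑ i, j i + j i) by rw [node]; ring, ← qPoch_add, add_comm 1, ← qPoch_add]
    congr 1
    omega
  have h4 := wellPoisedFactor_mul_balancedFactor (x := x) (a := a) (b := b) (d := d) hq hj
  have h5 := weight_self (h.mono hj)
  have h6 := qPoch_reverse (y := y) (z := a * q / (b * d) * q ^ ∑ i, (N - j) i) (K := ∑ i, j i)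
    hq (by rw [← hN, pow_add] at hy; linear_combination hy)
  have h7 := qPoch_add q (a * q / (b * d)) (∑ i, (N - j) i) (∑ i, j i)
  have hyJ : qPoch q y (∑ i, j i) ≠ 0 := by
    rw [qPoch_ne_zero_iff]
    exact fun s hs => hyK s (by omega)
  have h8 : weight q x j j * q ^ ((∑ l, N l) * ∑ l, j l) *
      (qPoch q (a * q / (b * d)) (∑ i, (N - j) i) * (a * q / (b * d)) ^ ∑ i, j i) =
      qPoch q (a * q / (b * d)) (∑ i, N i) / qPoch q y (∑ i, j i) := by
    rw [eq_div_iff hyJ, ← hN, h7, h6, hN]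
    have h9 := congrArg (· ^ ∑ i, j i) hy
    simp only [mul_pow, ← pow_mul] at h9
    rw [Nat.choose_succ_succ' _ 1, Nat.choose_one_right, pow_add] at h5
    have h10 : ((-1 : ℂ) ^ ∑ i, j i) * (-1) ^ ∑ i, j i = 1 := by
      rw [← mul_pow]; simp
    rw [neg_pow]
    set z := a * q / (b * d)
    linear_combination qPoch q z (∑ i, (N - j) i) *
      qPoch q (z * q ^ ∑ i, (N - j) i) (∑ i, j i) * (weight q x j j * (-1) ^ (∑ i, j i) *
        q ^ (∑ i, j i).choose 2 * h9 + (-1) ^ (∑ i, j i) * h5 + h10)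
  have hterm : ∀ m ∈ Iic (N - j), wellPoisedMatrix q x a N (j + m) * baileyMatrix q x a (j + m) j *
      wellPoisedFactor q x a b d (j + m) =
      weight q x j j * weight q x N j * (∏ i, qPoch q (a * x i) (∑ l, j l + j i) /
        qPoch q (a * x i * q ^ (1 + N i)) (∑ l, j l)) *
        q ^ (∑ l, j l + (∑ l, N l) * ∑ l, j l) * wellPoisedFactor q x a b d j *
      (wellPoisedMatrix q (node q x j) (a * q ^ ∑ l, j l) (N - j) m *
        wellPoisedFactor q (node q x j) (a * q ^ ∑ i, j i) b (d * q ^ ∑ i, j i) m) := by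
    intro m hm
    rw [wellPoisedFactor_add hq, wellPoisedMatrix_mul_baileyMatrix h
      ((add_le_add_right (mem_Iic.1 hm) j).trans_eq (add_tsub_cancel_of_le hj))]
    ring
  rw [Finset.sum_congr rfl hterm, ← Finset.mul_sum, h1, h2, pow_add]
  set A := ∏ i, qPoch q (a * x i) (∑ l, j l + j i) /
    qPoch q (a * x i * q ^ (1 + N i)) (∑ l, j l)
  set B := ∏ i, qPoch q (a * q ^ (∑ i, j i) * node q x j i) ((N - j) i + 1)
  rw [show balancedFactor q x a b d N = qPoch q (a * q / (b * d)) (∑ i, N i) /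
    (qPoch q (a * q / b) (∑ i, N i) * ∏ i, qPoch q (a * x i * q / d) (N i)) from rfl]
  set D := qPoch q (a * q / b) (∑ i, N i) * ∏ i, qPoch q (a * x i * q / d) (N i)
  linear_combination weight q x j j * weight q x N j * A * B * q ^ (∑ l, j l) *
    q ^ ((∑ l, N l) * ∑ l, j l) * h4 + weight q x N j * A * B * q ^ (∑ l, j l) *
    qPoch q d (∑ i, j i) * (∏ i, qPoch q (b * x i) (j i)) / D * h8

/-- The `A_n` Watson transformation, in terms of `wellPoisedMatrix`. -/
lemma sum_wellPoisedMatrix_mul_wellPoisedFactor_mul_wellPoisedFactor (h : Separated q x N)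
    (ha : a ≠ 0) (hb : b ≠ 0) (hc : c ≠ 0) (hd : d ≠ 0) (he : e ≠ 0)
    (hax : ∀ i, ∀ s < ∑ l, N l, 1 - a * x i * q ^ (1 + N i) * q ^ s ≠ 0)
    (hdx : ∀ i, ∀ s < N i, 1 - a * x i * q / d * q ^ s ≠ 0)
    (hex : ∀ i, ∀ s < N i, 1 - a * x i * q / e * q ^ s ≠ 0)
    (hbK : ∀ s < ∑ i, N i, 1 - a * q / b * q ^ s ≠ 0)
    (hcK : ∀ s < ∑ i, N i, 1 - a * q / c * q ^ s ≠ 0) {y : ℂ}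
    (hy : y * (a * q / (c * e)) * q ^ (∑ i, N i) = q) (hyK : ∀ s < ∑ i, N i, 1 - y * q ^ s ≠ 0) :
    ∑ k ∈ Iic N, wellPoisedMatrix q x a N k * wellPoisedFactor q x a b d k *
        wellPoisedFactor q x a c e k =
      (∏ i, qPoch q (a * x i) (N i + 1)) * balancedFactor q x a c e N *
        ∑ j ∈ Iic N, weight q x N j * (∏ i, qPoch q (c * x i) (j i)) *
          (qPoch q e (∑ i, j i) / qPoch q y (∑ i, j i)) * q ^ (∑ i, j i) *
            balancedFactor q x a b d j := by
  calc _ = ∑ k ∈ Iic N, ∑ j ∈ Iic N, wellPoisedMatrix q x a N k * baileyMatrix q x a k j *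
        wellPoisedFactor q x a c e k * balancedFactor q x a b d j := by
        refine Finset.sum_congr rfl fun k hk => ?_
        rw [← sum_baileyMatrix_mul_balancedFactor h ha hb hd hdx hbK (mem_Iic.1 hk),
          Finset.mul_sum, Finset.sum_mul]
        exact Finset.sum_congr rfl fun j _ => by ring
    _ = _ := by
        rw [Finset.sum_comm, Finset.mul_sum]
        refine Finset.sum_congr rfl fun j hj => ?_
        rw [← Finset.sum_mul, sum_wellPoisedMatrix_mul_baileyMatrix_mul_wellPoisedFactor h ha hc he
          hax hex hcK hy hyK (mem_Iic.1 hj)]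
        ring

end Watson

end MilneWatson

/-- `A_n` Watson transformation of Milne–Newcomb. -/
theorem stmt_18 (n : ℕ) (hn : 0 < n) (N : Fin n → ℕ) (q : ℂ) (hq : q ≠ 0)
    (hqru : ∀ m : ℕ, 0 < m → q ^ m ≠ 1)
    (a b c d e : ℂ) (x : Fin n → ℂ)
    (ha : a ≠ 0) (hb : b ≠ 0) (hc : c ≠ 0) (hd : d ≠ 0) (he : e ≠ 0)
    (hx : ∀ i, x i ≠ 0)
    (hxd : ∀ i j : Fin n, i ≠ j → x i ≠ x j)
    (hax : ∀ i, 1 - a * x i ≠ 0)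
    (hg1 : ∀ i j : Fin n, ∀ m ≤ N i, qPoch q (q * x i / x j) m ≠ 0)
    (hg2 : ∀ i : Fin n, ∀ m ≤ ∑ j, N j, qPoch q (a * x i * q ^ (1 + N i)) m ≠ 0)
    (hg3 : ∀ i : Fin n, ∀ m ≤ N i, qPoch q (a * x i * q / d) m ≠ 0)
    (hg4 : ∀ i : Fin n, ∀ m ≤ N i, qPoch q (a * x i * q / e) m ≠ 0)
    (hg5 : ∀ m ≤ ∑ j, N j, qPoch q (a * q / b) m ≠ 0)
    (hg6 : ∀ m ≤ ∑ j, N j, qPoch q (a * q / c) m ≠ 0)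
    (hg7 : ∀ m ≤ ∑ j, N j,
      qPoch q (c * e * q ^ (-(∑ j, N j : ℤ)) / a) m ≠ 0) :
    ∑ k ∈ Fintype.piFinset (fun i => Finset.range (N i + 1)),
      ((∏ i, ∏ j, if i < j then (x i * q ^ k i - x j * q ^ k j) / (x i - x j) else 1) *
        (∏ i, ∏ j, qPoch q (q ^ (-(N j : ℤ)) * x i / x j) (k i) /
          qPoch q (q * x i / x j) (k i)) *
        (∏ i, (1 - a * x i * q ^ (k i + ∑ j, k j)) / (1 - a * x i) *
          (qPoch q (a * x i) (∑ j, k j) /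
            qPoch q (a * x i * q ^ (1 + N i)) (∑ j, k j))) *
        (∏ i, qPoch q (b * x i) (k i) * qPoch q (c * x i) (k i) /
          (qPoch q (a * x i * q / d) (k i) * qPoch q (a * x i * q / e) (k i))) *
        (qPoch q d (∑ j, k j) * qPoch q e (∑ j, k j) /
          (qPoch q (a * q / b) (∑ j, k j) * qPoch q (a * q / c) (∑ j, k j))) *
        (a ^ 2 * q ^ ((∑ j, N j) + 2) / (b * c * d * e)) ^ (∑ j, k j)) =
      qPoch q (a * q / (c * e)) (∑ j, N j) / qPoch q (a * q / c) (∑ j, N j) *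
        (∏ i, qPoch q (a * x i * q) (N i) / qPoch q (a * x i * q / e) (N i)) *
        ∑ k ∈ Fintype.piFinset (fun i => Finset.range (N i + 1)),
          ((∏ i, ∏ j, if i < j then
              (x i * q ^ k i - x j * q ^ k j) / (x i - x j) else 1) *
            (∏ i, ∏ j, qPoch q (q ^ (-(N j : ℤ)) * x i / x j) (k i) /
              qPoch q (q * x i / x j) (k i)) *
            (∏ i, qPoch q (c * x i) (k i) / qPoch q (a * x i * q / d) (k i)) *
            (qPoch q (a * q / (b * d)) (∑ j, k j) * qPoch q e (∑ j, k j) /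
              (qPoch q (a * q / b) (∑ j, k j) *
                qPoch q (c * e * q ^ (-(∑ j, N j : ℤ)) / a) (∑ j, k j))) *
            q ^ (∑ j, k j)) := by
  have hqp : ∀ s : ℕ, q ^ s ≠ 0 := fun s => pow_ne_zero s hq
  have hsep : MilneWatson.Separated q x N := by
    refine ⟨hq, hqru, hx, fun i j hij s hs => ?_⟩
    rcases Nat.eq_zero_or_pos s with rfl | hs0
    · simpa using hxd i j hij
    · have h1 := (MilneWatson.qPoch_ne_zero_iff _ _ _).1 (hg1 i j (N i) le_rfl) (s - 1) (by omega)
      intro h2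
      apply h1
      have hxj := hx j
      rw [show q * x i / x j * q ^ (s - 1) = x i * q ^ (s - 1 + 1) / x j by ring,
        Nat.sub_add_cancel hs0, h2, div_self hxj, sub_self]
  have hset : Fintype.piFinset (fun i => Finset.range (N i + 1)) = Iic N := by
    ext k
    simp [Pi.le_def]
  have hy : c * e * q ^ (-(∑ j, N j : ℤ)) / a * (a * q / (c * e)) * q ^ (∑ i, N i) = q := by
    have h1 : q ^ (-(∑ j, N j : ℤ)) = (q ^ ∑ i, N i)⁻¹ := by
      rw [zpow_neg, ← Nat.cast_sum, zpow_natCast]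
    have := hqp (∑ i, N i)
    rw [h1]
    field_simp
  have hne := fun (y : ℂ) (k : ℕ) => (MilneWatson.qPoch_ne_zero_iff q y k).1
  have key := MilneWatson.sum_wellPoisedMatrix_mul_wellPoisedFactor_mul_wellPoisedFactor hsep
    ha hb hc hd he (fun i => hne _ _ (hg2 i _ le_rfl)) (fun i => hne _ _ (hg3 i _ le_rfl))
    (fun i => hne _ _ (hg4 i _ le_rfl)) (hne _ _ (hg5 _ le_rfl)) (hne _ _ (hg6 _ le_rfl)) hy
    (hne _ _ (hg7 _ le_rfl))
  have hP : ∏ i, (1 - a * x i) ≠ 0 := Finset.prod_ne_zero_iff.2 fun i _ => hax i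
  have hτ : ∏ i, qPoch q (a * x i) (N i + 1) = (∏ i, (1 - a * x i)) *
      ∏ i, qPoch q (a * x i * q) (N i) := by
    rw [← Finset.prod_mul_distrib]
    exact Finset.prod_congr rfl fun i _ => MilneWatson.qPoch_succ' _ _ _
  rw [hτ] at key
  rw [hset]
  apply mul_left_cancel₀ hP
  rw [Finset.mul_sum]
  refine (Finset.sum_congr rfl fun k _ => ?_).trans (key.trans ?_)
  · have hpow : (a ^ 2 * q ^ ((∑ j, N j) + 2) / (b * c * d * e)) ^ (∑ j, k j) =
        q ^ ((∑ j, N j) * ∑ j, k j) * ((a * q / (b * d)) ^ (∑ j, k j) *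
          (a * q / (c * e)) ^ ∑ j, k j) := by
      rw [pow_mul, ← mul_pow, ← mul_pow]
      congr 1
      field_simp
      ring
    rw [hpow]
    have hdiv : (∏ i, (1 - a * x i)) * ∏ i, (1 - a * x i * q ^ (k i + ∑ j, k j)) / (1 - a * x i) *
        (qPoch q (a * x i) (∑ j, k j) / qPoch q (a * x i * q ^ (1 + N i)) (∑ j, k j)) =
        ∏ i, (1 - a * x i * q ^ (k i + ∑ j, k j)) *
          (qPoch q (a * x i) (∑ j, k j) / qPoch q (a * x i * q ^ (1 + N i)) (∑ j, k j)) := by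
      rw [← Finset.prod_mul_distrib]
      refine Finset.prod_congr rfl fun i _ => ?_
      rw [← mul_assoc, mul_div_cancel₀ _ (hax i)]
    unfold MilneWatson.wellPoisedMatrix MilneWatson.wellPoisedFactor MilneWatson.weight
    rw [← hdiv]
    simp only [mul_div_mul_comm (qPoch _ _ _), Finset.prod_mul_distrib (f := fun i =>
      qPoch q (b * x i) (k i) / qPoch q (a * x i * q / d) (k i))]
    ring
  · rw [mul_assoc (∏ i, (1 - a * x i)), mul_assoc (∏ i, (1 - a * x i))]
    congr 1
    have h1 : (∏ i, qPoch q (a * x i * q) (N i)) * MilneWatson.balancedFactor q x a c e N =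
        qPoch q (a * q / (c * e)) (∑ j, N j) / qPoch q (a * q / c) (∑ j, N j) *
          (∏ i, qPoch q (a * x i * q) (N i) / qPoch q (a * x i * q / e) (N i)) := by
      rw [MilneWatson.balancedFactor, Finset.prod_div_distrib]
      ring
    rw [h1]
    congr 1
    refine Finset.sum_congr rfl fun k _ => ?_
    unfold MilneWatson.balancedFactor MilneWatson.weight
    rw [Finset.prod_div_distrib (f := fun i => qPoch q (c * x i) (k i))]
    simp only [div_eq_mul_inv, mul_inv]
    ring
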